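/- Let A be a one-clock priced timed automaton with a single cost function and all discrete costs 0, let C be the lcm of the positive location cost rates of A, and let Φ = EφU_{∼c}ψ be a WCTL formula. Then for every location q, the set of clock values x ∈ ℝ≥0 such that (q,x) ⊨ Φ is a finite union of intervals; moreover, the bounds of those intervals are integral multiples of 1/C^{h(Φ)} (where h(Φ) is the constrained temporal height of Φ), and the largest finite bound of those intervals is at most the maximal constant appearing in the guards of A. -/

import Mathlib

/-! ## One-clock priced timed automata: common definitions -/

/-- Comparison operators used in clock constraints and cost constraints. -/
inductive Cmp
  | lt | le | eq | ge | gt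
  deriving DecidableEq

/-- Satisfaction of `x ∼ c`. -/
def Cmp.sat : Cmp → ℝ → ℝ → Prop
  | .lt, x, c => x < c
  | .le, x, c => x ≤ c
  | .eq, x, c => x = c
  | .ge, x, c => c ≤ x
  | .gt, x, c => c < x

/-- A guard (clock constraint) is a finite conjunction of constraints `x ∼ c`, `c ∈ ℕ`. -/
abbrev PGuard := List (Cmp × ℕ)

/-- A clock value satisfies a guard if it satisfies all its atomic constraints. -/
def PGuard.sat (g : PGuard) (x : ℝ) : Prop := ∀ p ∈ g, Cmp.sat p.1 x (p.2 : ℝ)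

/-- A transition of a one-clock priced timed automaton: source, guard, reset set
(`reset = true` iff the clock is reset), target, and discrete cost. -/
structure PTrans (Q : Type) where
  src : Q
  guard : PGuard
  reset : Bool
  tgt : Q
  dcost : ℕ

/-- A one-clock priced timed automaton with a single cost function:
a finite set `Q` of locations, an initial location, a finite set of transitions,
invariants, and a cost rate for each location (discrete costs are on transitions). -/
structure PTA (Q : Type) [Fintype Q] where
  init : Q
  E : Set (PTrans Q)
  finE : E.Finite
  Inv : Q → PGuard
  rate : Q → ℕ

variable {Q : Type} [Fintype Q]

/-- A delay move `(q,v) → (q,v+t)` of cost `t · rate q`, allowed if the invariant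
holds throughout. -/
def DelayMove (A : PTA Q) (s : Q × ℝ) (c : ℝ) (s' : Q × ℝ) : Prop :=
  ∃ t : ℝ, 0 ≤ t ∧ s' = (s.1, s.2 + t) ∧ c = t * (A.rate s.1 : ℝ) ∧
    ∀ t' : ℝ, 0 ≤ t' → t' ≤ t → PGuard.sat (A.Inv s.1) (s.2 + t')

/-- A discrete move via a transition of `A`, of cost the discrete cost of the transition. -/
def DiscMove (A : PTA Q) (s : Q × ℝ) (c : ℝ) (s' : Q × ℝ) : Prop :=
  ∃ e ∈ A.E, e.src = s.1 ∧ e.tgt = s'.1 ∧ PGuard.sat e.guard s.2 ∧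
    s'.2 = (if e.reset then 0 else s.2) ∧ PGuard.sat (A.Inv e.tgt) s'.2 ∧ c = (e.dcost : ℝ)

/-- A simple move of the timed transition system `TTS_A`. -/
def PMove (A : PTA Q) (s : Q × ℝ) (c : ℝ) (s' : Q × ℝ) : Prop :=
  DelayMove A s c s' ∨ DiscMove A s c s'

/-- `PPath A s c s'`: there is a path (finite sequence of simple moves) in `TTS_A`
from `s` to `s'` of total cost `c`. -/
inductive PPath (A : PTA Q) : (Q × ℝ) → ℝ → (Q × ℝ) → Prop
  | refl (s : Q × ℝ) : PPath A s 0 s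
  | step {s s' s'' : Q × ℝ} {c c' : ℝ} :
      PMove A s c s' → PPath A s' c' s'' → PPath A s (c + c') s''

/-- Reachability in `TTS_A` (notation `⇝*` in the paper). -/
def PReach (A : PTA Q) (s s' : Q × ℝ) : Prop := ∃ c : ℝ, PPath A s c s'

/-- A mixed move: a delay move followed by a discrete move. -/
def MixedMove (A : PTA Q) (s : Q × ℝ) (c : ℝ) (s' : Q × ℝ) : Prop :=
  ∃ (c₁ c₂ : ℝ) (m : Q × ℝ), DelayMove A s c₁ m ∧ DiscMove A m c₂ s' ∧ c = c₁ + c₂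

/-- A priced timed automaton is non-blocking. -/
def NonBlocking (A : PTA Q) : Prop :=
  ∀ (q : Q) (v : ℝ), 0 ≤ v → ∃ (c : ℝ) (s' : Q × ℝ), MixedMove A (q, v) c s'

/-- The constants appearing in the clock constraints (guards and invariants) of `A`. -/
def PTA.consts (A : PTA Q) : Set ℕ :=
  {c | (∃ e ∈ A.E, ∃ p ∈ e.guard, p.2 = c) ∨ ∃ q : Q, ∃ p ∈ A.Inv q, p.2 = c}

/-- The lcm of all positive cost rates labeling a location of `A`. -/
def posLcm (A : PTA Q) : ℕ :=
  Finset.lcm (Finset.univ.filter fun q => 0 < A.rate q) A.rate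

/-! ## WCTL: syntax and semantics -/

/-- Syntax of WCTL over atomic propositions `AP` (with a trivially true formula `tt`). -/
inductive WCTL (AP : Type)
  | tt : WCTL AP
  | atom : AP → WCTL AP
  | not : WCTL AP → WCTL AP
  | or : WCTL AP → WCTL AP → WCTL AP
  | EU : WCTL AP → Cmp → ℕ → WCTL AP → WCTL AP
  | AU : WCTL AP → Cmp → ℕ → WCTL AP → WCTL AP

/-- An infinite run of `A` from `s₀`: an infinite sequence of mixed moves,
`cst n` being the cost of the `n`-th mixed move. -/
structure InfRun (A : PTA Q) (s₀ : Q × ℝ) where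
  st : ℕ → Q × ℝ
  cst : ℕ → ℝ
  first : st 0 = s₀
  step : ∀ n : ℕ, MixedMove A (st n) (cst n) (st (n + 1))

/-- Satisfaction of WCTL formulas over states of a labeled one-clock priced timed
automaton (`L` is the labeling function). -/
def WCTLsat {AP : Type} (A : PTA Q) (L : Q → AP → Prop) : WCTL AP → (Q × ℝ) → Prop
  | .tt, _ => True
  | .atom a, s => L s.1 a
  | .not φ, s => ¬ WCTLsat A L φ s
  | .or φ ψ, s => WCTLsat A L φ s ∨ WCTLsat A L ψ s
  | .EU φ cmp c ψ, s => ∃ ρ : InfRun A s, ∃ π : ℕ, 0 < π ∧ WCTLsat A L ψ (ρ.st π) ∧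
      (∀ π' : ℕ, 0 < π' → π' < π → WCTLsat A L φ (ρ.st π')) ∧
      Cmp.sat cmp (∑ i ∈ Finset.range π, ρ.cst i) (c : ℝ)
  | .AU φ cmp c ψ, s => ∀ ρ : InfRun A s, ∃ π : ℕ, 0 < π ∧ WCTLsat A L ψ (ρ.st π) ∧
      (∀ π' : ℕ, 0 < π' → π' < π → WCTLsat A L φ (ρ.st π')) ∧
      Cmp.sat cmp (∑ i ∈ Finset.range π, ρ.cst i) (c : ℝ)

/-- A cost constraint `∼ c` is trivial iff it is `≥ 0`. -/
def isTrivialC : Cmp → ℕ → Bool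
  | .ge, 0 => true
  | _, _ => false

/-- The constrained temporal height of a WCTL formula: the maximal number of nested
constrained modalities (modalities whose constraint is not equivalent to `≥ 0`). -/
def cheight {AP : Type} : WCTL AP → ℕ
  | .tt => 0
  | .atom _ => 0
  | .not φ => cheight φ
  | .or φ ψ => max (cheight φ) (cheight ψ)
  | .EU φ cmp c ψ => max (cheight φ) (cheight ψ) + (if isTrivialC cmp c then 0 else 1)
  | .AU φ cmp c ψ => max (cheight φ) (cheight ψ) + (if isTrivialC cmp c then 0 else 1)

/-! ## Regions and intervals -/

/-- The regions determined by the constants `a 0 < a 1 < … < a n` (with `a (n+1) = +∞`):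
the singletons `{a i}`, the open intervals `(a i, a (i+1))`, and `(a n, +∞)`. -/
def Regions (a : ℕ → ℝ) (n : ℕ) : Set (Set ℝ) :=
  {r | (∃ i ≤ n, r = {a i}) ∨ (∃ i < n, r = Set.Ioo (a i) (a (i + 1))) ∨ r = Set.Ioi (a n)}

/-- Shapes of intervals: closed/open at each end, `ci`/`oi` being right-unbounded. -/
inductive IShape
  | cc | co | oc | oo | ci | oi
  deriving DecidableEq

/-- The interval of the given shape with the given (left, right) endpoints
(the right endpoint is ignored for the right-unbounded shapes `ci` and `oi`). -/
def mkInterval : IShape → ℝ → ℝ → Set ℝ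
  | .cc, l, r => Set.Icc l r
  | .co, l, r => Set.Ico l r
  | .oc, l, r => Set.Ioc l r
  | .oo, l, r => Set.Ioo l r
  | .ci, l, _ => Set.Ici l
  | .oi, l, _ => Set.Ioi l

open MeasureTheory

/-! ## Grid cells -/

/-- `x` and `y` lie in the same cell of the grid of multiples of `1 / N`. -/
def SameCell (N : ℕ) (x y : ℝ) : Prop :=
  ∀ m : ℤ, ((m : ℝ) ≤ N * x ↔ (m : ℝ) ≤ N * y) ∧ (N * x ≤ m ↔ N * y ≤ m)

/-- `y` lies in the closure of the cell of `x` in the grid of multiples of `1 / N`. -/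
def InClosedCell (N : ℕ) (x y : ℝ) : Prop :=
  ∀ m : ℤ, ((m : ℝ) ≤ N * x → (m : ℝ) ≤ N * y) ∧ (N * x ≤ m → N * y ≤ m)

theorem SameCell.refl (N : ℕ) (x : ℝ) : SameCell N x x := fun _ => ⟨Iff.rfl, Iff.rfl⟩

theorem SameCell.symm {N : ℕ} {x y : ℝ} (h : SameCell N x y) : SameCell N y x :=
  fun m => ⟨(h m).1.symm, (h m).2.symm⟩

theorem SameCell.of_dvd {N N' : ℕ} (hN : N ∣ N') (hpos : 0 < N') {x y : ℝ}
    (h : SameCell N' x y) : SameCell N x y := by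
  obtain ⟨k, rfl⟩ := hN
  have hk : (0 : ℝ) < k := by exact_mod_cast Nat.pos_of_mul_pos_left hpos
  intro m
  have h1 := h (m * k)
  push_cast at h1
  have e : ∀ z : ℝ, (N : ℝ) * k * z = N * z * k := fun z => by ring
  simpa only [e, mul_le_mul_iff_left₀ hk] using h1

theorem SameCell.combo {N : ℕ} {x y z s : ℝ} (hy : SameCell N x y) (hz : InClosedCell N x z)
    (hs : 0 < s) (hs1 : s ≤ 1) : SameCell N x (s * y + (1 - s) * z) := by
  intro m
  have e : (N : ℝ) * (s * y + (1 - s) * z) = s * (N * y) + (1 - s) * (N * z) := by ring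
  have hy' := hy m
  have hz' := hz m
  rw [e]
  refine ⟨⟨fun h => ?_, fun h => ?_⟩, ⟨fun h => ?_, fun h => ?_⟩⟩
  · nlinarith [hy'.1.1 h, hz'.1 h]
  · by_contra hc
    have h1 := lt_of_not_ge fun h' => hc (hy'.1.2 h')
    have h2 := hz'.2 (le_of_not_ge hc)
    nlinarith
  · nlinarith [hy'.2.1 h, hz'.2 h]
  · by_contra hc
    have h1 := lt_of_not_ge fun h' => hc (hy'.2.2 h')
    have h2 := hz'.1 (le_of_not_ge hc)
    nlinarith

theorem SameCell.inClosedCell {N : ℕ} {x y : ℝ} (h : SameCell N x y) : InClosedCell N x y :=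
  fun m => ⟨(h m).1.1, (h m).2.1⟩

theorem SameCell.cmp_sat {N : ℕ} (hN : 0 < N) {x y : ℝ} (h : SameCell N x y) (o : Cmp) (c : ℕ) :
    Cmp.sat o x c ↔ Cmp.sat o y c := by
  have hN' : (0 : ℝ) < N := by exact_mod_cast hN
  have h1 := h (N * c)
  push_cast at h1
  simp only [mul_le_mul_iff_right₀ hN'] at h1
  cases o <;> simp only [Cmp.sat, ← not_le, le_antisymm_iff, h1.1, h1.2]

/-! ## Timings -/

/-- A timing starting from `x`: `(τ i).1` and `(τ i).2` are the clock values before and after the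
`i`-th delay, which is followed by a reset of the clock when `reset i` holds. -/
structure Timing (reset : ℕ → Bool) (x : ℝ) (τ : ℕ → ℝ × ℝ) : Prop where
  init : (τ 0).1 = x
  le : ∀ i, (τ i).1 ≤ (τ i).2
  next : ∀ i, (τ (i + 1)).1 = if reset i then 0 else (τ i).2

/-- The timing `σ` visits the same grid cells as `τ` and has the same null delays. -/
structure Tracks (N : ℕ) (τ σ : ℕ → ℝ × ℝ) : Prop where
  fst : ∀ i, SameCell N (τ i).1 (σ i).1
  snd : ∀ i, SameCell N (τ i).2 (σ i).2
  lt : ∀ i, (τ i).1 < (τ i).2 ↔ (σ i).1 < (σ i).2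

/-- The timing `σ` is a degenerate limit of timings which track `τ`. -/
structure WeaklyTracks (N : ℕ) (τ σ : ℕ → ℝ × ℝ) : Prop where
  fst : ∀ i, InClosedCell N (τ i).1 (σ i).1
  snd : ∀ i, InClosedCell N (τ i).2 (σ i).2
  eq : ∀ i, (τ i).1 = (τ i).2 → (σ i).1 = (σ i).2

/-- The barycenter of two timings. -/
def mix (s : ℝ) (τ₁ τ₂ : ℕ → ℝ × ℝ) : ℕ → ℝ × ℝ :=
  fun i => (s * (τ₁ i).1 + (1 - s) * (τ₂ i).1, s * (τ₁ i).2 + (1 - s) * (τ₂ i).2)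

/-- The cost of the first `n` delays of a timing, the `i`-th one being spent at rate `r i`. -/
def tcost (r : ℕ → ℕ) (τ : ℕ → ℝ × ℝ) (n : ℕ) : ℝ :=
  ∑ i ∈ Finset.range n, ((τ i).2 - (τ i).1) * r i

theorem tcost_mix (r : ℕ → ℕ) (s : ℝ) (τ₁ τ₂ : ℕ → ℝ × ℝ) (n : ℕ) :
    tcost r (mix s τ₁ τ₂) n = s * tcost r τ₁ n + (1 - s) * tcost r τ₂ n := by
  simp only [tcost, mix, Finset.mul_sum, ← Finset.sum_add_distrib]
  exact Finset.sum_congr rfl fun i _ => by ring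

theorem tcost_zero (r : ℕ → ℕ) (τ : ℕ → ℝ × ℝ) : tcost r τ 0 = 0 := by simp [tcost]

theorem tcost_succ (r : ℕ → ℕ) (τ : ℕ → ℝ × ℝ) (n : ℕ) :
    tcost r τ (n + 1) = tcost r τ n + ((τ n).2 - (τ n).1) * r n := by
  simp [tcost, Finset.sum_range_succ]

theorem Timing.mix {reset : ℕ → Bool} {x s : ℝ} {τ₁ τ₂ : ℕ → ℝ × ℝ} (h₁ : Timing reset x τ₁)
    (h₂ : Timing reset x τ₂) (hs : 0 ≤ s) (hs1 : s ≤ 1) : Timing reset x (mix s τ₁ τ₂) where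
  init := by simp only [_root_.mix, h₁.init, h₂.init]; ring
  le i := by
    have := h₁.le i
    have := h₂.le i
    simp only [_root_.mix]
    nlinarith
  next i := by
    simp only [_root_.mix, h₁.next, h₂.next]
    split_ifs <;> ring

theorem Timing.tcost_mono {reset : ℕ → Bool} {x : ℝ} {τ : ℕ → ℝ × ℝ} (h : Timing reset x τ)
    (r : ℕ → ℕ) : Monotone (tcost r τ) := by
  refine monotone_nat_of_le_succ fun n => ?_
  rw [tcost_succ]
  have := mul_nonneg (sub_nonneg.2 (h.le n)) (Nat.cast_nonneg (α := ℝ) (r n))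
  linarith

theorem Timing.tcost_nonneg {reset : ℕ → Bool} {x : ℝ} {τ : ℕ → ℝ × ℝ} (h : Timing reset x τ)
    (r : ℕ → ℕ) (n : ℕ) : 0 ≤ tcost r τ n := by
  simpa [tcost_zero] using h.tcost_mono r (Nat.zero_le n)

theorem Timing.nonneg {reset : ℕ → Bool} {x : ℝ} {τ : ℕ → ℝ × ℝ} (h : Timing reset x τ)
    (hx : 0 ≤ x) (i : ℕ) : 0 ≤ (τ i).1 := by
  induction i with
  | zero => rw [h.init]; exact hx
  | succ n ih =>
    rw [h.next]
    split_ifs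
    · exact le_rfl
    · exact ih.trans (h.le n)

theorem Tracks.mix {N : ℕ} {x s : ℝ} {reset : ℕ → Bool} {τ τ₁ τ₂ : ℕ → ℝ × ℝ}
    (h₁ : Tracks N τ τ₁) (h₂ : WeaklyTracks N τ τ₂) (ht₁ : Timing reset x τ₁)
    (ht₂ : Timing reset x τ₂) {x₀ : ℝ} (ht : Timing reset x₀ τ) (hs : 0 < s) (hs1 : s ≤ 1) :
    Tracks N τ (mix s τ₁ τ₂) where
  fst i := (h₁.fst i).combo (h₂.fst i) hs hs1
  snd i := (h₁.snd i).combo (h₂.snd i) hs hs1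
  lt i := by
    simp only [_root_.mix]
    constructor
    · intro h
      have := (h₁.lt i).1 h
      have := ht₂.le i
      nlinarith
    · intro h
      by_contra hc
      have e : (τ i).1 = (τ i).2 := le_antisymm (ht.le i) (not_lt.1 hc)
      have e₁ : (τ₁ i).1 = (τ₁ i).2 :=
        le_antisymm (ht₁.le i) (not_lt.1 fun h' => hc ((h₁.lt i).2 h'))
      rw [h₂.eq i e, e₁] at h
      exact lt_irrefl _ h

theorem Tracks.weaklyTracks {N : ℕ} {x' : ℝ} {reset : ℕ → Bool} {τ τ' : ℕ → ℝ × ℝ}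
    (h : Tracks N τ τ') (ht' : Timing reset x' τ') :
    WeaklyTracks N τ τ' where
  fst i := (h.fst i).inClosedCell
  snd i := (h.snd i).inClosedCell
  eq i e := le_antisymm (ht'.le i) (not_lt.1 fun h' => ((h.lt i).2 h').ne e)

theorem Timing.tcost_lt_iff_exists {reset : ℕ → Bool} {x : ℝ} {τ : ℕ → ℝ × ℝ}
    (h : Timing reset x τ) (r : ℕ → ℕ) (n m : ℕ) :
    tcost r τ n < tcost r τ m ↔ ∃ i, n ≤ i ∧ i < m ∧ (τ i).1 < (τ i).2 ∧ 0 < r i := by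
  constructor
  · intro hlt
    by_contra! hc
    refine hlt.not_ge ?_
    have key : ∀ k, n + k ≤ m → tcost r τ (n + k) = tcost r τ n := by
      intro k
      induction k with
      | zero => simp
      | succ k ih =>
        intro hk
        rw [← add_assoc, tcost_succ, ih (by omega)]
        rcases (h.le (n + k)).lt_or_eq with h1 | h1
        · have := hc (n + k) (by omega) (by omega) h1
          simp [Nat.le_zero.1 this]
        · simp [h1]
    rcases le_total n m with hnm | hnm
    · obtain ⟨k, rfl⟩ := Nat.exists_eq_add_of_le hnm
      exact (key k le_rfl).le
    · exact h.tcost_mono r hnm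
  · rintro ⟨i, hni, him, hlt, hr⟩
    calc tcost r τ n ≤ tcost r τ i := h.tcost_mono r hni
      _ < tcost r τ (i + 1) := by
        rw [tcost_succ]
        have := mul_pos (sub_pos.2 hlt) (Nat.cast_pos (α := ℝ).2 hr)
        linarith
      _ ≤ tcost r τ m := h.tcost_mono r him

theorem Tracks.tcost_lt_iff {N : ℕ} {x x' : ℝ} {reset : ℕ → Bool} {τ τ' : ℕ → ℝ × ℝ}
    (h : Tracks N τ τ') (ht : Timing reset x τ) (ht' : Timing reset x' τ') (r : ℕ → ℕ) (n m : ℕ) :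
    tcost r τ n < tcost r τ m ↔ tcost r τ' n < tcost r τ' m := by
  rw [ht.tcost_lt_iff_exists, ht'.tcost_lt_iff_exists]
  simp only [h.lt]

/-! ## Matching the position of the accumulated costs with respect to a bound -/

/-- The uniform probability measure on `[0, 1)`. -/
noncomputable def unitMeasure : Measure ℝ := volume.restrict (Set.Ico 0 1)

instance : IsProbabilityMeasure unitMeasure := ⟨by simp [unitMeasure]⟩

theorem ae_mem_unit : ∀ᵐ θ ∂unitMeasure, θ ∈ Set.Ico (0 : ℝ) 1 :=
  ae_restrict_mem measurableSet_Ico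

theorem exists_le_integral_unit {f : ℝ → ℝ} (hf : Integrable f unitMeasure) :
    ∃ θ ∈ Set.Ico (0 : ℝ) 1, f θ ≤ ∫ θ, f θ ∂unitMeasure := by
  obtain ⟨θ, h, h'⟩ := exists_notMem_null_le_integral (N := (Set.Ico (0 : ℝ) 1)ᶜ) hf ae_mem_unit
  exact ⟨θ, not_not.1 h, h'⟩

theorem exists_integral_le_unit {f : ℝ → ℝ} (hf : Integrable f unitMeasure) :
    ∃ θ ∈ Set.Ico (0 : ℝ) 1, ∫ θ, f θ ∂unitMeasure ≤ f θ := by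
  obtain ⟨θ, hθ, hle⟩ := exists_notMem_null_integral_le (N := (Set.Ico (0 : ℝ) 1)ᶜ) hf ae_mem_unit
  exact ⟨θ, not_not.1 hθ, hle⟩

/-- If `f` and `g` are on the same side of `c` and `f` has mean `c` then either `g` has mean `c`
or `g` takes values on both sides of `c`. -/
theorem integral_eq_or_exists_lt_gt {f g : ℝ → ℝ} (hf : Integrable f unitMeasure) {c : ℝ}
    (hfg : ∀ θ ∈ Set.Ico (0 : ℝ) 1, (f θ < c ↔ g θ < c) ∧ (c < f θ ↔ c < g θ))
    (hc : ∫ θ, f θ ∂unitMeasure = c) :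
    ∫ θ, g θ ∂unitMeasure = c ∨
      ((∃ θ ∈ Set.Ico (0 : ℝ) 1, g θ < c) ∧ ∃ θ ∈ Set.Ico (0 : ℝ) 1, c < g θ) := by
  have conclude : f =ᵐ[unitMeasure] (fun _ => c) → ∫ θ, g θ ∂unitMeasure = c := by
    intro h
    have : g =ᵐ[unitMeasure] fun _ => c := by
      filter_upwards [h, ae_mem_unit] with θ h1 h2
      refine le_antisymm (not_lt.1 fun h3 => ?_) (not_lt.1 fun h3 => ?_)
      · exact ((hfg θ h2).2.2 h3).ne' h1
      · exact ((hfg θ h2).1.2 h3).ne h1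
    rw [integral_congr_ae this]
    simp
  by_cases h1 : ∃ θ ∈ Set.Ico (0 : ℝ) 1, g θ < c
  · by_cases h2 : ∃ θ ∈ Set.Ico (0 : ℝ) 1, c < g θ
    · exact Or.inr ⟨h1, h2⟩
    · push Not at h2
      left
      refine conclude ((integral_eq_iff_of_ae_le hf (integrable_const c) ?_).1 (by simp [hc]))
      filter_upwards [ae_mem_unit] with θ h
      exact not_lt.1 fun h' => (h2 θ h).not_gt ((hfg θ h).2.1 h')
  · push Not at h1
    left
    refine conclude (((integral_eq_iff_of_ae_le (integrable_const c) hf ?_).1 (by simp [hc])).symm)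
    filter_upwards [ae_mem_unit] with θ h
    exact not_lt.1 fun hlt => (h1 θ h).not_gt ((hfg θ h).1.1 hlt)

/-- Two timings have the same accumulated costs relative to the bound `c`. -/
def SameSide (r : ℕ → ℕ) (c : ℝ) (τ σ : ℕ → ℝ × ℝ) : Prop :=
  ∀ n, (tcost r τ n < c ↔ tcost r σ n < c) ∧ (c < tcost r τ n ↔ c < tcost r σ n)

/-- A timing `τ` from `x`, a timing `τ'` from `x'` which tracks it, and degenerate timings
`W θ` and `W' θ` which average to `τ` and `τ'` and have the same costs relative to `c`. -/
structure Rounding (reset : ℕ → Bool) (r : ℕ → ℕ) (N : ℕ) (c x x' : ℝ) (τ τ' : ℕ → ℝ × ℝ)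
    (W W' : ℝ → ℕ → ℝ × ℝ) : Prop where
  timing : Timing reset x τ
  timing' : Timing reset x' τ'
  tracks : Tracks N τ τ'
  timingW : ∀ θ ∈ Set.Ico (0 : ℝ) 1, Timing reset x (W θ)
  timingW' : ∀ θ ∈ Set.Ico (0 : ℝ) 1, Timing reset x' (W' θ)
  weakly : ∀ θ ∈ Set.Ico (0 : ℝ) 1, WeaklyTracks N τ (W' θ)
  integrable : ∀ n, Integrable (fun θ => tcost r (W θ) n) unitMeasure
  integral : ∀ n, ∫ θ, tcost r (W θ) n ∂unitMeasure = tcost r τ n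
  integrable' : ∀ n, Integrable (fun θ => tcost r (W' θ) n) unitMeasure
  integral' : ∀ n, ∫ θ, tcost r (W' θ) n ∂unitMeasure = tcost r τ' n
  sameSide : ∀ θ ∈ Set.Ico (0 : ℝ) 1, SameSide r c (W θ) (W' θ)
  gap : ∃ ε > 0, ∀ θ ∈ Set.Ico (0 : ℝ) 1, ∀ n, tcost r (W' θ) n < c → tcost r (W' θ) n ≤ c - ε
  bound : ∃ B, 0 ≤ B ∧ ∀ n, tcost r τ' n ≤ B * tcost r τ n

namespace Rounding

variable {reset : ℕ → Bool} {r : ℕ → ℕ} {N : ℕ} {c x x' : ℝ} {τ τ' : ℕ → ℝ × ℝ}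
  {W W' : ℝ → ℕ → ℝ × ℝ}

theorem good_mix (h : Rounding reset r N c x x' τ τ' W W') {θ s : ℝ}
    (hθ : θ ∈ Set.Ico (0 : ℝ) 1) (hs : 0 < s) (hs1 : s ≤ 1) :
    Timing reset x' (mix s τ' (W' θ)) ∧ Tracks N τ (mix s τ' (W' θ)) :=
  ⟨h.timing'.mix (h.timingW' θ hθ) hs.le hs1,
    h.tracks.mix (h.weakly θ hθ) h.timing' (h.timingW' θ hθ) h.timing hs hs1⟩

/-- A small positive weight on `a` keeps a barycenter of `a` and `b` below `c` when `b < c`. -/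
theorem _root_.exists_combo_lt {a b c : ℝ} (hb : b < c) :
    ∃ s : ℝ, 0 < s ∧ s ≤ 1 ∧ s * a + (1 - s) * b < c := by
  by_cases ha : a < c
  · exact ⟨1, one_pos, le_rfl, by linarith⟩
  · have hd : 0 < a - b := by linarith
    refine ⟨(c - b) / (2 * (a - b)), by apply div_pos <;> linarith, ?_, ?_⟩
    · rw [div_le_one (by linarith)]; linarith
    · have : (c - b) / (2 * (a - b)) * (a - b) = (c - b) / 2 := by field_simp
      linarith

theorem _root_.exists_combo_gt {a b c : ℝ} (hb : c < b) :
    ∃ s : ℝ, 0 < s ∧ s ≤ 1 ∧ c < s * a + (1 - s) * b := by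
  obtain ⟨s, h1, h2, h3⟩ := exists_combo_lt (a := -a) (neg_lt_neg hb)
  exact ⟨s, h1, h2, by linarith⟩

theorem _root_.exists_combo_eq {a b c : ℝ} (hb : b < c) (ha : c ≤ a) :
    ∃ s : ℝ, 0 < s ∧ s ≤ 1 ∧ s * a + (1 - s) * b = c := by
  have hd : 0 < a - b := by linarith
  refine ⟨(c - b) / (a - b), by apply div_pos <;> linarith, ?_, ?_⟩
  · rw [div_le_one (by linarith)]; linarith
  · have : (c - b) / (a - b) * (a - b) = (c - b) := by field_simp
    linarith

theorem exists_lt (h : Rounding reset r N c x x' τ τ' W W') {n : ℕ} (hn : tcost r τ n < c) :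
    ∃ σ, Timing reset x' σ ∧ Tracks N τ σ ∧ tcost r σ n < c := by
  obtain ⟨θ, hθ, h1⟩ := exists_le_integral_unit (h.integrable n)
  rw [h.integral] at h1
  have h2 := (h.sameSide θ hθ n).1.1 (h1.trans_lt hn)
  obtain ⟨s, hs, hs1, h3⟩ := exists_combo_lt (a := tcost r τ' n) h2
  exact ⟨_, (h.good_mix hθ hs hs1).1, (h.good_mix hθ hs hs1).2, by rwa [tcost_mix]⟩

theorem exists_gt (h : Rounding reset r N c x x' τ τ' W W') {n : ℕ} (hn : c < tcost r τ n) :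
    ∃ σ, Timing reset x' σ ∧ Tracks N τ σ ∧ c < tcost r σ n := by
  obtain ⟨θ, hθ, h1⟩ := exists_integral_le_unit (h.integrable n)
  rw [h.integral] at h1
  have h2 := (h.sameSide θ hθ n).2.1 (hn.trans_le h1)
  obtain ⟨s, hs, hs1, h3⟩ := exists_combo_gt (a := tcost r τ' n) h2
  exact ⟨_, (h.good_mix hθ hs hs1).1, (h.good_mix hθ hs hs1).2, by rwa [tcost_mix]⟩

theorem exists_eq (h : Rounding reset r N c x x' τ τ' W W') {n : ℕ} (hn : tcost r τ n = c) :
    ∃ σ, Timing reset x' σ ∧ Tracks N τ σ ∧ tcost r σ n = c := by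
  have := integral_eq_or_exists_lt_gt (h.integrable n) (fun θ hθ => h.sameSide θ hθ n)
    (by rw [h.integral, hn])
  rw [h.integral'] at this
  rcases this with h1 | ⟨⟨θ, hθ, h1⟩, ⟨θ', hθ', h2⟩⟩
  · exact ⟨τ', h.timing', h.tracks, h1⟩
  · rcases le_total c (tcost r τ' n) with h3 | h3
    · obtain ⟨s, hs, hs1, h4⟩ := exists_combo_eq h1 h3
      exact ⟨_, (h.good_mix hθ hs hs1).1, (h.good_mix hθ hs hs1).2, by rwa [tcost_mix]⟩
    · obtain ⟨s, hs, hs1, h4⟩ := exists_combo_eq (neg_lt_neg h2) (neg_le_neg h3)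
      exact ⟨_, (h.good_mix hθ' hs hs1).1, (h.good_mix hθ' hs hs1).2, by
        rw [tcost_mix]; linarith⟩

/-- The bound can be jumped over by the same delay. -/
theorem exists_jump (h : Rounding reset r N c x x' τ τ' W W') {n : ℕ} (hn : tcost r τ n < c)
    (hn1 : c < tcost r τ (n + 1)) :
    ∃ σ, Timing reset x' σ ∧ Tracks N τ σ ∧ tcost r σ n < c ∧ c < tcost r σ (n + 1) := by
  obtain ⟨σ₁, ht₁, hσ₁, h₁⟩ := h.exists_lt hn
  obtain ⟨σ₂, ht₂, hσ₂, h₂⟩ := h.exists_gt hn1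
  have l₁ := (hσ₁.tcost_lt_iff h.timing ht₁ r n (n + 1)).1 (hn.trans hn1)
  have l₂ := (hσ₂.tcost_lt_iff h.timing ht₂ r n (n + 1)).1 (hn.trans hn1)
  by_cases c₁ : c < tcost r σ₁ (n + 1)
  · exact ⟨σ₁, ht₁, hσ₁, h₁, c₁⟩
  by_cases c₂ : tcost r σ₂ n < c
  · exact ⟨σ₂, ht₂, hσ₂, c₂, h₂⟩
  push Not at c₁ c₂
  obtain ⟨s, hs, hs1, h4⟩ := exists_combo_eq
    (a := (tcost r σ₂ n + tcost r σ₂ (n + 1)) / 2) (b := (tcost r σ₁ n + tcost r σ₁ (n + 1)) / 2)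
    (c := c) (by linarith) (by linarith)
  have ht := ht₂.mix ht₁ hs.le hs1
  have hσ := hσ₂.mix (hσ₁.weaklyTracks ht₁) ht₂ ht₁ h.timing hs hs1
  have l := (hσ.tcost_lt_iff h.timing ht r n (n + 1)).1 (hn.trans hn1)
  refine ⟨_, ht, hσ, ?_⟩
  rw [tcost_mix, tcost_mix] at *
  constructor <;> linarith

theorem exists_forall_lt (h : Rounding reset r N c x x' τ τ' W W') (hc : ∀ n, tcost r τ n < c) :
    ∃ σ, Timing reset x' σ ∧ Tracks N τ σ ∧ ∀ n, tcost r σ n < c := by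
  by_cases hW : ∃ θ ∈ Set.Ico (0 : ℝ) 1, ∀ n, tcost r (W θ) n < c
  · obtain ⟨θ, hθ, h1⟩ := hW
    obtain ⟨ε, hε, h2⟩ := h.gap
    obtain ⟨B, hB0, hB⟩ := h.bound
    obtain ⟨s, hs, hs1, h3⟩ := exists_combo_lt (a := B * c) (b := c - ε) (c := c) (by linarith)
    refine ⟨_, (h.good_mix hθ hs hs1).1, (h.good_mix hθ hs hs1).2, fun n => ?_⟩
    rw [tcost_mix]
    have h4 := h2 θ hθ n ((h.sameSide θ hθ n).1.1 (h1 n))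
    have h5 : tcost r τ' n ≤ B * c := (hB n).trans (mul_le_mul_of_nonneg_left (hc n).le hB0)
    nlinarith
  · push Not at hW
    have hc0 : 0 < c := (tcost_zero r τ).symm.trans_lt (hc 0)
    have hint : ∀ n, ∫⁻ θ, ENNReal.ofReal (tcost r (W θ) n) ∂unitMeasure
        = ENNReal.ofReal (tcost r τ n) := fun n => by
      rw [← ofReal_integral_eq_lintegral_ofReal (h.integrable n), h.integral]
      filter_upwards [ae_mem_unit] with θ hθ using (h.timingW θ hθ).tcost_nonneg r n
    have hmeas : ∀ n, AEMeasurable (fun θ => ENNReal.ofReal (tcost r (W θ) n)) unitMeasure :=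
      fun n => (h.integrable n).aestronglyMeasurable.aemeasurable.ennreal_ofReal
    have hsup : ∫⁻ θ, ⨆ n, ENNReal.ofReal (tcost r (W θ) n) ∂unitMeasure
        = ⨆ n, ENNReal.ofReal (tcost r τ n) := by
      rw [lintegral_iSup' hmeas]
      · simp only [hint]
      · filter_upwards [ae_mem_unit] with θ hθ n m hnm
        exact ENNReal.ofReal_le_ofReal ((h.timingW θ hθ).tcost_mono r hnm)
    have hge : (fun _ => ENNReal.ofReal c) ≤ᵐ[unitMeasure]
        fun θ => ⨆ n, ENNReal.ofReal (tcost r (W θ) n) := by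
      filter_upwards [ae_mem_unit] with θ hθ
      obtain ⟨n, hn⟩ := hW θ hθ
      exact (ENNReal.ofReal_le_ofReal hn).trans
        (le_iSup (fun n => ENNReal.ofReal (tcost r (W θ) n)) n)
    have hge' : ENNReal.ofReal c ≤ ⨆ n, ENNReal.ofReal (tcost r τ n) := by
      rw [← hsup]
      simpa using lintegral_mono_ae hge
    have hae := ae_eq_of_ae_le_of_lintegral_le hge (by simp) (AEMeasurable.iSup hmeas) (by
      rw [hsup]
      simpa using fun n => ENNReal.ofReal_le_ofReal (hc n).le)
    have hle : ∀ n, tcost r τ' n ≤ c := by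
      intro n
      rw [← h.integral']
      have : (fun θ => tcost r (W' θ) n) ≤ᵐ[unitMeasure] fun _ => c := by
        filter_upwards [hae, ae_mem_unit] with θ h1 hθ
        refine not_lt.1 fun h2 => ?_
        have h3 := (h.sameSide θ hθ n).2.2 h2
        have h4 := le_iSup (fun n => ENNReal.ofReal (tcost r (W θ) n)) n
        rw [← h1] at h4
        exact h4.not_gt ((ENNReal.ofReal_lt_ofReal_iff (hc0.trans h3)).2 h3)
      simpa using integral_mono_ae (h.integrable' n) (integrable_const c) this
    refine ⟨τ', h.timing', h.tracks, fun n => (hle n).lt_of_ne fun he => ?_⟩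
    have hconst : ∀ m, tcost r τ m ≤ tcost r τ n := fun m => by
      refine not_lt.1 fun h1 => ?_
      have := (h.tracks.tcost_lt_iff h.timing h.timing' r n m).1 h1
      exact ((hle m).trans he.ge).not_gt this
    have : ENNReal.ofReal c ≤ ENNReal.ofReal (tcost r τ n) :=
      hge'.trans (iSup_le fun m => ENNReal.ofReal_le_ofReal (hconst m))
    exact this.not_gt ((ENNReal.ofReal_lt_ofReal_iff hc0).2 (hc n))

theorem exists_sameSide (h : Rounding reset r N c x x' τ τ' W W') (hc : 0 ≤ c) :
    ∃ σ, Timing reset x' σ ∧ Tracks N τ σ ∧ SameSide r c τ σ := by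
  classical
  by_cases hlt : ∀ n, tcost r τ n < c
  · obtain ⟨σ, ht, hσ, h1⟩ := h.exists_forall_lt hlt
    exact ⟨σ, ht, hσ, fun n => by simp [hlt n, h1 n, (hlt n).not_gt, (h1 n).not_gt]⟩
  push Not at hlt
  have hmin : ∀ n < Nat.find hlt, tcost r τ n < c := fun n hn => not_le.1 (Nat.find_min hlt hn)
  rcases (Nat.find_spec hlt).eq_or_lt with heq | hgt
  · obtain ⟨σ, ht, hσ, h1⟩ := h.exists_eq heq.symm
    refine ⟨σ, ht, hσ, fun n => ?_⟩
    have e1 := hσ.tcost_lt_iff h.timing ht r n (Nat.find hlt)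
    have e2 := hσ.tcost_lt_iff h.timing ht r (Nat.find hlt) n
    rw [← heq, h1] at e1 e2
    exact ⟨e1, e2⟩
  · obtain ⟨k, hk⟩ : ∃ k, Nat.find hlt = k + 1 := by
      refine Nat.exists_eq_succ_of_ne_zero fun h0 => ?_
      rw [h0, tcost_zero] at hgt
      exact hgt.not_ge hc
    rw [hk] at hgt hmin
    obtain ⟨σ, ht, hσ, h1, h2⟩ := h.exists_jump (hmin k (by omega)) hgt
    refine ⟨σ, ht, hσ, fun n => ?_⟩
    rcases Nat.lt_or_ge k n with hn | hn
    · have a1 := hgt.trans_le (h.timing.tcost_mono r (Nat.succ_le_of_lt hn))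
      have a2 := h2.trans_le (ht.tcost_mono r (Nat.succ_le_of_lt hn))
      simp [a1, a2, a1.not_gt, a2.not_gt]
    · have a1 := hmin n (by omega)
      have a2 := (ht.tcost_mono r hn).trans_lt h1
      simp [a1, a2, a1.not_gt, a2.not_gt]

end Rounding


/-! ## Threshold rounding of timings -/

/-- No reset occurs before the `i`-th delay. -/
def FirstLeg (reset : ℕ → Bool) (i : ℕ) : Prop := ∀ j < i, reset j = false

open Classical in
/-- Apply `α` to the clock values before the first reset and `β` to the other ones. -/
noncomputable def mapTiming (reset : ℕ → Bool) (α β : ℝ → ℝ) (τ : ℕ → ℝ × ℝ) : ℕ → ℝ × ℝ :=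
  fun i => if FirstLeg reset i then (α (τ i).1, α (τ i).2) else (β (τ i).1, β (τ i).2)

section MapTiming

variable {reset : ℕ → Bool} {x X : ℝ} {τ : ℕ → ℝ × ℝ} {α β : ℝ → ℝ}

theorem mapTiming_of_firstLeg {i : ℕ} (h : FirstLeg reset i) :
    mapTiming reset α β τ i = (α (τ i).1, α (τ i).2) := if_pos h

theorem mapTiming_of_not_firstLeg {i : ℕ} (h : ¬ FirstLeg reset i) :
    mapTiming reset α β τ i = (β (τ i).1, β (τ i).2) := if_neg h

theorem firstLeg_zero : FirstLeg reset 0 := fun j hj => absurd hj (Nat.not_lt_zero j)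

theorem firstLeg_succ {i : ℕ} :
    FirstLeg reset (i + 1) ↔ FirstLeg reset i ∧ reset i = false := by
  refine ⟨fun h => ⟨fun j hj => h j (by omega), h i (by omega)⟩, fun h j hj => ?_⟩
  rcases Nat.lt_succ_iff_lt_or_eq.1 hj with h1 | rfl
  · exact h.1 j h1
  · exact h.2

theorem Timing.le_of_firstLeg (h : Timing reset x τ) {i : ℕ} (hi : FirstLeg reset i) :
    x ≤ (τ i).1 := by
  induction i with
  | zero => exact h.init.ge
  | succ n ih =>
    rw [firstLeg_succ] at hi
    rw [h.next, hi.2]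
    exact (ih hi.1).trans (h.le n)

theorem Timing.map (h : Timing reset x τ) (hx : 0 ≤ x) (hα : MonotoneOn α (Set.Ici x))
    (hβ : MonotoneOn β (Set.Ici 0)) (hαx : α x = X) (hβ0 : β 0 = 0) :
    Timing reset X (mapTiming reset α β τ) where
  init := by rw [mapTiming_of_firstLeg firstLeg_zero, h.init, hαx]
  le i := by
    by_cases hi : FirstLeg reset i
    · rw [mapTiming_of_firstLeg hi]
      have := h.le_of_firstLeg hi
      exact hα this (this.trans (h.le i)) (h.le i)
    · rw [mapTiming_of_not_firstLeg hi]
      have := h.nonneg hx i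
      exact hβ this (this.trans (h.le i)) (h.le i)
  next i := by
    by_cases hi : FirstLeg reset i
    · rw [mapTiming_of_firstLeg hi]
      cases hr : reset i
      · rw [mapTiming_of_firstLeg (firstLeg_succ.2 ⟨hi, hr⟩), h.next, hr]
        simp
      · rw [mapTiming_of_not_firstLeg (fun h' => by simp [(firstLeg_succ.1 h').2] at hr), h.next,
          hr]
        simp [hβ0]
    · rw [mapTiming_of_not_firstLeg hi,
        mapTiming_of_not_firstLeg (fun h' => hi (firstLeg_succ.1 h').1), h.next]
      cases reset i <;> simp [hβ0]

theorem Timing.tracks_map {N : ℕ} (h : Timing reset x τ) (hx : 0 ≤ x)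
    (hα : StrictMonoOn α (Set.Ici x)) (hβ : StrictMonoOn β (Set.Ici 0))
    (hαN : ∀ y, x ≤ y → SameCell N y (α y)) (hβN : ∀ y, 0 ≤ y → SameCell N y (β y)) :
    Tracks N τ (mapTiming reset α β τ) := by
  have key : ∀ i, SameCell N (τ i).1 (mapTiming reset α β τ i).1 ∧
      SameCell N (τ i).2 (mapTiming reset α β τ i).2 ∧
      ((τ i).1 < (τ i).2 ↔
        (mapTiming reset α β τ i).1 < (mapTiming reset α β τ i).2) := by
    intro i
    have hle := h.le i
    by_cases hi : FirstLeg reset i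
    · rw [mapTiming_of_firstLeg hi]
      have := h.le_of_firstLeg hi
      exact ⟨hαN _ this, hαN _ (this.trans hle), (hα.lt_iff_lt this (this.trans hle)).symm⟩
    · rw [mapTiming_of_not_firstLeg hi]
      have := h.nonneg hx i
      exact ⟨hβN _ this, hβN _ (this.trans hle), (hβ.lt_iff_lt this (this.trans hle)).symm⟩
  exact ⟨fun i => (key i).1, fun i => (key i).2.1, fun i => (key i).2.2⟩

theorem Timing.weaklyTracks_map {N : ℕ} (h : Timing reset x τ) (hx : 0 ≤ x)
    (hαN : ∀ y, x ≤ y → InClosedCell N y (α y)) (hβN : ∀ y, 0 ≤ y → InClosedCell N y (β y)) :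
    WeaklyTracks N τ (mapTiming reset α β τ) := by
  have key : ∀ i, InClosedCell N (τ i).1 (mapTiming reset α β τ i).1 ∧
      InClosedCell N (τ i).2 (mapTiming reset α β τ i).2 ∧
      ((τ i).1 = (τ i).2 →
        (mapTiming reset α β τ i).1 = (mapTiming reset α β τ i).2) := by
    intro i
    have hle := h.le i
    by_cases hi : FirstLeg reset i
    · rw [mapTiming_of_firstLeg hi]
      have := h.le_of_firstLeg hi
      exact ⟨hαN _ this, hαN _ (this.trans hle), fun e => by simp only [e]⟩
    · rw [mapTiming_of_not_firstLeg hi]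
      have := h.nonneg hx i
      exact ⟨hβN _ this, hβN _ (this.trans hle), fun e => by simp only [e]⟩
  exact ⟨fun i => (key i).1, fun i => (key i).2.1, fun i => (key i).2.2⟩

end MapTiming

/-- Rounding to the grid of multiples of `1 / N` with threshold `1 - θ`. -/
noncomputable def gridRound (N : ℕ) (θ y : ℝ) : ℝ := ⌊N * y + θ⌋ / N

/-- Affine map from `[x, b]` to `[X, b]`, extended by the identity. -/
noncomputable def legStretch (x b X y : ℝ) : ℝ :=
  if y < b then X + (b - X) * ((y - x) / (b - x)) else y

/-- Threshold rounding of the values in `[x, b)` to `X` or `b`, and to the grid beyond `b`. -/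
noncomputable def legRound (N : ℕ) (x b X θ y : ℝ) : ℝ :=
  if y < b then X + (b - X) * ⌊(y - x) / (b - x) + θ⌋ else gridRound N θ y

theorem integrable_floor_add (z : ℝ) :
    Integrable (fun θ : ℝ => (⌊z + θ⌋ : ℝ)) unitMeasure ∧
      ∫ θ, (⌊z + θ⌋ : ℝ) ∂unitMeasure = z := by
  have hae : (fun θ : ℝ => (⌊z + θ⌋ : ℝ)) =ᵐ[unitMeasure]
      fun θ => (⌊z⌋ : ℝ) + (Set.Ici (1 - Int.fract z)).indicator (fun _ => (1 : ℝ)) θ := by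
    filter_upwards [ae_mem_unit] with θ hθ
    have h0 := Int.fract_nonneg z
    have h1 := Int.fract_lt_one z
    have h2 := Int.floor_add_fract z
    by_cases h : 1 - Int.fract z ≤ θ
    · rw [Set.indicator_of_mem (show θ ∈ Set.Ici (1 - Int.fract z) from h)]
      have : ⌊z + θ⌋ = ⌊z⌋ + 1 := by
        rw [Int.floor_eq_iff]; push_cast; constructor <;> linarith [hθ.2]
      rw [this]; push_cast; ring
    · rw [Set.indicator_of_notMem (show θ ∉ Set.Ici (1 - Int.fract z) from h)]
      have : ⌊z + θ⌋ = ⌊z⌋ := by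
        rw [Int.floor_eq_iff]; constructor <;> linarith [hθ.1, not_le.1 h]
      rw [this]; ring
  have hind : Integrable ((Set.Ici (1 - Int.fract z)).indicator (fun _ => (1 : ℝ)))
      unitMeasure := (integrable_const 1).indicator measurableSet_Ici
  refine ⟨((integrable_const _).add hind).congr hae.symm, ?_⟩
  rw [integral_congr_ae hae, integral_add (integrable_const _) hind,
    integral_indicator measurableSet_Ici]
  have hset : Set.Ici (1 - Int.fract z) ∩ Set.Ico 0 1 = Set.Ico (1 - Int.fract z) 1 := by
    ext θ
    have := Int.fract_lt_one z
    simp only [Set.mem_inter_iff, Set.mem_Ici, Set.mem_Ico]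
    constructor
    · rintro ⟨h1, _, h2⟩; exact ⟨h1, h2⟩
    · rintro ⟨h1, h2⟩; exact ⟨h1, by linarith, h2⟩
  have hvol : (unitMeasure.restrict (Set.Ici (1 - Int.fract z))).real Set.univ = Int.fract z := by
    rw [measureReal_restrict_apply_univ, unitMeasure, measureReal_def,
      Measure.restrict_apply measurableSet_Ici, hset, Real.volume_Ico]
    rw [ENNReal.toReal_ofReal (by linarith [Int.fract_nonneg z])]
    ring
  simp only [integral_const, hvol, smul_eq_mul, mul_one, probReal_univ, one_mul]
  exact Int.floor_add_fract z

theorem integrable_gridRound {N : ℕ} (hN : 0 < N) (y : ℝ) :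
    Integrable (fun θ => gridRound N θ y) unitMeasure ∧
      ∫ θ, gridRound N θ y ∂unitMeasure = y := by
  have hN' : (N : ℝ) ≠ 0 := by exact_mod_cast hN.ne'
  obtain ⟨h1, h2⟩ := integrable_floor_add (N * y)
  refine ⟨h1.div_const _, ?_⟩
  simp only [gridRound, integral_div, h2]
  field_simp

theorem integrable_legRound {N : ℕ} (hN : 0 < N) (x b X y : ℝ) :
    Integrable (fun θ => legRound N x b X θ y) unitMeasure ∧
      ∫ θ, legRound N x b X θ y ∂unitMeasure = legStretch x b X y := by
  unfold legRound legStretch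
  split_ifs with h
  · obtain ⟨h1, h2⟩ := integrable_floor_add ((y - x) / (b - x))
    refine ⟨(integrable_const _).add (h1.const_mul _), ?_⟩
    rw [integral_add (integrable_const _) (h1.const_mul _), integral_const_mul, h2]
    simp
  · exact integrable_gridRound hN y

theorem gridRound_mono (N : ℕ) (θ : ℝ) : Monotone (gridRound N θ) := by
  intro y z h
  unfold gridRound
  gcongr

theorem gridRound_zero (N : ℕ) {θ : ℝ} (hθ : θ ∈ Set.Ico (0 : ℝ) 1) : gridRound N θ 0 = 0 := by
  have : ⌊θ⌋ = 0 := Int.floor_eq_zero_iff.2 hθ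
  simp [gridRound, this]

theorem inClosedCell_gridRound {N : ℕ} (hN : 0 < N) {θ : ℝ} (hθ : θ ∈ Set.Ico (0 : ℝ) 1)
    (y : ℝ) : InClosedCell N y (gridRound N θ y) := by
  have hN' : (N : ℝ) ≠ 0 := by exact_mod_cast hN.ne'
  intro m
  have e : (N : ℝ) * gridRound N θ y = ⌊N * y + θ⌋ := by unfold gridRound; field_simp
  rw [e]
  norm_cast
  refine ⟨fun h => Int.le_floor.2 (by linarith [hθ.1]), fun h => ?_⟩
  rw [← Int.lt_add_one_iff, Int.floor_lt]
  push_cast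
  linarith [hθ.2]

/-- Two values in the same open cell. -/
theorem sameCell_of_mem_Ioo {N : ℕ} {k : ℤ} {y z : ℝ} (hy : (k : ℝ) < N * y)
    (hy' : N * y < k + 1) (hz : (k : ℝ) < N * z) (hz' : N * z < k + 1) : SameCell N y z := by
  intro m
  rcases le_or_gt m k with h | h
  · have h1 : (m : ℝ) ≤ k := by exact_mod_cast h
    exact ⟨⟨fun _ => by linarith, fun _ => by linarith⟩,
      ⟨fun _ => by linarith, fun _ => by linarith⟩⟩
  · have h1 : (k : ℝ) + 1 ≤ m := by exact_mod_cast h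
    exact ⟨⟨fun _ => by linarith, fun _ => by linarith⟩,
      ⟨fun _ => by linarith, fun _ => by linarith⟩⟩

theorem inClosedCell_of_mem_Ioo {N : ℕ} {k : ℤ} {y z : ℝ} (hy : (k : ℝ) < N * y)
    (hy' : N * y < k + 1) (hz : (k : ℝ) ≤ N * z) (hz' : N * z ≤ k + 1) : InClosedCell N y z := by
  intro m
  rcases le_or_gt m k with h | h
  · have h1 : (m : ℝ) ≤ k := by exact_mod_cast h
    exact ⟨fun _ => by linarith, fun _ => by linarith⟩
  · have h1 : (k : ℝ) + 1 ≤ m := by exact_mod_cast h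
    exact ⟨fun _ => by linarith, fun _ => by linarith⟩

/-- `x` lies in the open grid cell `((N b - 1) / N, b)`. -/
structure OpenCell (N : ℕ) (b x : ℝ) : Prop where
  pos : 0 < N
  grid : ∃ k : ℤ, N * b = k + 1
  lower : N * b - 1 < N * x
  lt : x < b

namespace OpenCell

variable {N : ℕ} {x X b θ : ℝ}

theorem legStretch_start (hx : OpenCell N b x) : legStretch x b X x = X := by
  simp [legStretch, hx.lt]

theorem legRound_start (hx : OpenCell N b x) (hθ : θ ∈ Set.Ico (0 : ℝ) 1) :
    legRound N x b X θ x = X := by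
  have : ⌊θ⌋ = 0 := Int.floor_eq_zero_iff.2 hθ
  simp [legRound, hx.lt, this]

theorem legStretch_self (hx : OpenCell N b x) (y : ℝ) : legStretch x b x y = y := by
  have := hx.lt
  unfold legStretch
  split_ifs
  · have : b - x ≠ 0 := by linarith
    field_simp
    ring
  · rfl

theorem legStretch_strictMonoOn (hx : OpenCell N b x) (hX : OpenCell N b X) :
    StrictMonoOn (legStretch x b X) (Set.Ici x) := by
  intro y hy z hz hyz
  have hb : 0 < b - x := by linarith [hx.lt]
  have hB : 0 < b - X := by linarith [hX.lt]
  unfold legStretch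
  by_cases h1 : z < b
  · rw [if_pos h1, if_pos (hyz.trans h1)]
    gcongr
  · rw [if_neg h1]
    split_ifs with h2
    · have : (y - x) / (b - x) < 1 := by rw [div_lt_one hb]; linarith
      nlinarith
    · exact hyz

theorem sameCell_legStretch (hx : OpenCell N b x) (hX : OpenCell N b X) {y : ℝ} (hy : x ≤ y) :
    SameCell N y (legStretch x b X y) := by
  have hN : (0 : ℝ) < N := by exact_mod_cast hx.pos
  by_cases h : y < b
  · obtain ⟨k, hk⟩ := hx.grid
    have h1 := (hx.legStretch_strictMonoOn hX).monotoneOn (Set.mem_Ici.2 le_rfl) hy hy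
    rw [hx.legStretch_start] at h1
    have h2 := hx.legStretch_strictMonoOn hX hy (hy.trans h.le) h
    have h3 : legStretch x b X b = b := by simp [legStretch]
    rw [h3] at h2
    have a1 := hx.lower
    have a2 := hX.lower
    refine sameCell_of_mem_Ioo (k := k) ?_ ?_ ?_ ?_ <;> nlinarith
  · simpa [legStretch, h] using SameCell.refl N y

/-- The values which are rounded down to the starting point. -/
def AtStart (x b θ y : ℝ) : Prop := y < b ∧ (y - x) / (b - x) + θ < 1

theorem legRound_of_atStart (hx : OpenCell N b x) (hθ : θ ∈ Set.Ico (0 : ℝ) 1) {y : ℝ}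
    (hy : x ≤ y) (h : AtStart x b θ y) : legRound N x b X θ y = X := by
  have hb : 0 < b - x := by linarith [hx.lt]
  have : ⌊(y - x) / (b - x) + θ⌋ = 0 := Int.floor_eq_zero_iff.2
    ⟨add_nonneg (div_nonneg (by linarith) hb.le) hθ.1, h.2⟩
  simp [legRound, h.1, this]

theorem legRound_of_lt (hx : OpenCell N b x) (hθ : θ ∈ Set.Ico (0 : ℝ) 1) {y : ℝ}
    (hyb : y < b) (h : ¬ AtStart x b θ y) : legRound N x b X θ y = b := by
  have hb : 0 < b - x := by linarith [hx.lt]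
  have h1 : (y - x) / (b - x) < 1 := by rw [div_lt_one hb]; linarith
  have : ⌊(y - x) / (b - x) + θ⌋ = 1 := by
    rw [Int.floor_eq_iff]
    push_cast
    exact ⟨not_lt.1 fun h' => h ⟨hyb, h'⟩, by linarith [hθ.2]⟩
  simp [legRound, hyb, this]

theorem le_gridRound (hx : OpenCell N b x) (hθ : θ ∈ Set.Ico (0 : ℝ) 1) {y : ℝ}
    (hy : b ≤ y) : b ≤ gridRound N θ y := by
  have hN : (0 : ℝ) < N := by exact_mod_cast hx.pos
  obtain ⟨k, hk⟩ := hx.grid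
  have := (inClosedCell_gridRound hx.pos hθ y (k + 1)).1 (by push_cast; nlinarith)
  push_cast at this
  nlinarith

theorem legRound_monotoneOn (hx : OpenCell N b x) (hX : OpenCell N b X)
    (hθ : θ ∈ Set.Ico (0 : ℝ) 1) : MonotoneOn (legRound N x b X θ) (Set.Ici x) := by
  intro y hy z hz hyz
  have hb : 0 < b - x := by linarith [hx.lt]
  have hB : 0 < b - X := by linarith [hX.lt]
  by_cases h1 : z < b
  · simp only [legRound, h1, hyz.trans_lt h1, if_true]
    gcongr
  · by_cases h2 : y < b
    · have h3 : legRound N x b X θ z = gridRound N θ z := if_neg h1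
      rw [h3]
      refine le_trans ?_ (hx.le_gridRound hθ (not_lt.1 h1))
      by_cases h4 : AtStart x b θ y
      · rw [hx.legRound_of_atStart hθ hy h4]; exact hX.lt.le
      · exact (hx.legRound_of_lt hθ h2 h4).le
    · simp only [legRound, h1, h2, if_false]
      exact gridRound_mono N θ hyz

theorem inClosedCell_legRound (hx : OpenCell N b x) (hX : OpenCell N b X)
    (hθ : θ ∈ Set.Ico (0 : ℝ) 1) {y : ℝ} (hy : x ≤ y) :
    InClosedCell N y (legRound N x b X θ y) := by
  have hN : (0 : ℝ) < N := by exact_mod_cast hx.pos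
  by_cases h : y < b
  · obtain ⟨k, hk⟩ := hx.grid
    have a1 := hx.lower
    have a2 := hX.lower
    have a3 := hX.lt
    have : legRound N x b X θ y = X ∨ legRound N x b X θ y = b := by
      by_cases h4 : AtStart x b θ y
      · exact Or.inl (hx.legRound_of_atStart hθ hy h4)
      · exact Or.inr (hx.legRound_of_lt hθ h h4)
    refine inClosedCell_of_mem_Ioo (k := k) ?_ ?_ ?_ ?_
    · nlinarith
    · nlinarith
    · rcases this with e | e <;> rw [e] <;> nlinarith
    · rcases this with e | e <;> rw [e] <;> nlinarith
  · simpa [legRound, h] using inClosedCell_gridRound hx.pos hθ y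

theorem legRound_of_not_atStart (hx : OpenCell N b x) (hθ : θ ∈ Set.Ico (0 : ℝ) 1) {y : ℝ}
    (h : ¬ AtStart x b θ y) : ∃ m : ℤ, ∀ X, legRound N x b X θ y = m / N := by
  have hN : (N : ℝ) ≠ 0 := by exact_mod_cast hx.pos.ne'
  by_cases hyb : y < b
  · obtain ⟨k, hk⟩ := hx.grid
    refine ⟨k + 1, fun X => ?_⟩
    rw [hx.legRound_of_lt hθ hyb h]
    push_cast
    rw [← hk]
    field_simp
  · exact ⟨_, fun X => if_neg hyb⟩

theorem atStart_of_le (hx : OpenCell N b x) {y z : ℝ} (hyz : y ≤ z) (h : AtStart x b θ z) :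
    AtStart x b θ y := by
  have hb : 0 < b - x := by linarith [hx.lt]
  refine ⟨hyz.trans_lt h.1, lt_of_le_of_lt ?_ h.2⟩
  gcongr

/-- The cost of a rounded timing is of the form `K / N - ρ X`, where `X` is the starting point. -/
theorem tcost_round (hx : OpenCell N b x) (hθ : θ ∈ Set.Ico (0 : ℝ) 1) {reset : ℕ → Bool}
    {r : ℕ → ℕ} {C : ℕ} (hr : ∀ i, r i = 0 ∨ r i ∣ C) {τ : ℕ → ℝ × ℝ} (hτ : Timing reset x τ)
    (n : ℕ) : ∃ (K : ℤ) (ρ : ℕ), (ρ = 0 ∨ ρ ∣ C) ∧ ∀ X,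
      tcost r (mapTiming reset (legRound N x b X θ) (gridRound N θ) τ) n = K / N - ρ * X := by
  suffices ∃ (K : ℤ) (ρ : ℕ), (ρ = 0 ∨ ρ ∣ C) ∧
      (FirstLeg reset n ∧ AtStart x b θ (τ n).1 → ρ = 0) ∧ ∀ X,
      tcost r (mapTiming reset (legRound N x b X θ) (gridRound N θ) τ) n = K / N - ρ * X by
    obtain ⟨K, ρ, h1, -, h2⟩ := this
    exact ⟨K, ρ, h1, h2⟩
  induction n with
  | zero => exact ⟨0, 0, Or.inl rfl, fun _ => rfl, fun X => by simp [tcost_zero]⟩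
  | succ n ih =>
    obtain ⟨K, ρ, h1, h2, h3⟩ := ih
    simp only [tcost_succ, h3]
    by_cases hn : FirstLeg reset n
    · simp only [mapTiming_of_firstLeg hn]
      have hle := hτ.le_of_firstLeg hn
      have hnext : FirstLeg reset (n + 1) ∧ AtStart x b θ (τ (n + 1)).1 →
          AtStart x b θ (τ n).2 := by
        rintro ⟨h4, h5⟩
        rwa [hτ.next, (firstLeg_succ.1 h4).2] at h5
      by_cases hv : AtStart x b θ (τ n).1
      · obtain rfl := h2 ⟨hn, hv⟩
        by_cases hw : AtStart x b θ (τ n).2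
        · refine ⟨K, 0, h1, fun _ => rfl, fun X => ?_⟩
          rw [hx.legRound_of_atStart hθ hle hv,
            hx.legRound_of_atStart hθ (hle.trans (hτ.le n)) hw]
          ring
        · obtain ⟨m, hm⟩ := hx.legRound_of_not_atStart hθ hw
          refine ⟨K + m * r n, r n, hr n, fun h => absurd (hnext h) hw, fun X => ?_⟩
          rw [hx.legRound_of_atStart hθ hle hv, hm]
          push_cast
          ring
      · have hw : ¬ AtStart x b θ (τ n).2 := fun h => hv (hx.atStart_of_le (hτ.le n) h)
        obtain ⟨m, hm⟩ := hx.legRound_of_not_atStart hθ hw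
        obtain ⟨m', hm'⟩ := hx.legRound_of_not_atStart hθ hv
        refine ⟨K + (m - m') * r n, ρ, h1, fun h => absurd (hnext h) hw, fun X => ?_⟩
        rw [hm, hm']
        push_cast
        ring
    · simp only [mapTiming_of_not_firstLeg hn]
      refine ⟨K + (⌊N * (τ n).2 + θ⌋ - ⌊N * (τ n).1 + θ⌋) * r n, ρ, h1,
        fun h => absurd (firstLeg_succ.1 h.1).1 hn, fun X => ?_⟩
      simp only [gridRound]
      push_cast
      ring

theorem legStretch_sub_le (hx : OpenCell N b x) (hX : OpenCell N b X) {y z : ℝ}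
    (hyz : y ≤ z) : legStretch x b X z - legStretch x b X y ≤
      (1 + (b - X) / (b - x)) * (z - y) := by
  have hb : 0 < b - x := by linarith [hx.lt]
  have hB : 0 < b - X := by linarith [hX.lt]
  have hσ : 0 < (b - X) / (b - x) := div_pos hB hb
  have e : ∀ u, X + (b - X) * ((u - x) / (b - x)) = b - (b - X) / (b - x) * (b - u) := by
    intro u
    field_simp
    ring
  unfold legStretch
  simp only [e]
  set σ := (b - X) / (b - x)
  by_cases h1 : z < b
  · rw [if_pos h1, if_pos (hyz.trans_lt h1)]
    nlinarith
  · rw [if_neg h1]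
    split_ifs with h2
    · nlinarith [mul_nonneg hσ.le (sub_nonneg.2 (not_lt.1 h1))]
    · nlinarith

end OpenCell

theorem SameCell.side_iff {N C : ℕ} (hN : 0 < N) (hC : 0 < C) {x y : ℝ}
    (h : SameCell (C * N) x y) {ρ : ℕ} (hρ : ρ = 0 ∨ ρ ∣ C) (K : ℤ) (c : ℕ) :
    ((K : ℝ) / N - ρ * x < c ↔ (K : ℝ) / N - ρ * y < c) ∧
      ((c : ℝ) < K / N - ρ * x ↔ (c : ℝ) < K / N - ρ * y) := by
  rcases hρ with rfl | ⟨t, rfl⟩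
  · simp
  · have ht : (0 : ℝ) < t := by exact_mod_cast Nat.pos_of_mul_pos_left hC
    have hN' : (0 : ℝ) < N := by exact_mod_cast hN
    have h1 := h ((K - N * c) * t)
    push_cast at h1
    have e : ∀ z : ℝ, ((K : ℝ) - N * c) * t - ρ * t * N * z
        = (K / N - ρ * z - c) * (N * t) := by
      intro z
      field_simp
      ring
    have p : (0 : ℝ) < N * t := mul_pos hN' ht
    have e1 : ∀ z : ℝ, ((K : ℝ) / N - ρ * z < c ↔ ¬ (ρ * t * N * z ≤ (K - N * c) * t)) := by
      intro z
      have := e z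
      rw [not_le]
      constructor
      · intro h; nlinarith
      · intro h
        by_contra h'
        nlinarith
    have e2 : ∀ z : ℝ, ((c : ℝ) < K / N - ρ * z ↔ ¬ ((K - N * c) * t ≤ ρ * t * N * z)) := by
      intro z
      have := e z
      rw [not_le]
      constructor
      · intro h; nlinarith
      · intro h
        by_contra h'
        nlinarith
    rw [e1, e1, e2, e2, h1.1, h1.2]
    exact ⟨Iff.rfl, Iff.rfl⟩

theorem exists_gap_int_add (z : ℝ) : ∃ δ > 0, ∀ j : ℤ, 0 < (j : ℝ) + z → δ ≤ (j : ℝ) + z := by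
  have hz := Int.floor_add_fract z
  have h0 := Int.fract_nonneg z
  have h1 := Int.fract_lt_one z
  rcases h0.eq_or_lt with h | h
  · refine ⟨1, one_pos, fun j hj => ?_⟩
    have : 0 < j + ⌊z⌋ := by
      have : (0 : ℝ) < ((j + ⌊z⌋ : ℤ) : ℝ) := by push_cast; linarith
      exact_mod_cast this
    have : (1 : ℝ) ≤ ((j + ⌊z⌋ : ℤ) : ℝ) := by exact_mod_cast this
    push_cast at this
    linarith
  · refine ⟨Int.fract z, h, fun j hj => ?_⟩
    have : -1 < j + ⌊z⌋ := by
      have : (-1 : ℝ) < ((j + ⌊z⌋ : ℤ) : ℝ) := by push_cast; linarith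
      exact_mod_cast this
    have : (0 : ℝ) ≤ ((j + ⌊z⌋ : ℤ) : ℝ) := by exact_mod_cast (by omega : 0 ≤ j + ⌊z⌋)
    push_cast at this
    linarith

theorem exists_gap_below {N C : ℕ} (hN : 0 < N) (hC : 0 < C) (X : ℝ) (c : ℕ) :
    ∃ ε > 0, ∀ (K : ℤ) (ρ : ℕ), (ρ = 0 ∨ ρ ∣ C) → (K : ℝ) / N - ρ * X < c →
      (K : ℝ) / N - ρ * X ≤ c - ε := by
  have hN' : (0 : ℝ) < N := by exact_mod_cast hN
  choose δ hδ hδ' using fun ρ : ℕ => exists_gap_int_add (N * (ρ * X))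
  obtain ⟨ρ₀, -, hmin⟩ := Finset.exists_min_image (Finset.range (C + 1)) δ ⟨0, by simp⟩
  refine ⟨δ ρ₀ / N, div_pos (hδ ρ₀) hN', fun K ρ hρ hlt => ?_⟩
  have hmem : ρ ∈ Finset.range (C + 1) := by
    rcases hρ with rfl | h
    · simp
    · exact Finset.mem_range_succ_iff.2 (Nat.le_of_dvd hC h)
  have e : (((N * c - K : ℤ)) : ℝ) + N * (ρ * X) = (c - (K / N - ρ * X)) * N := by
    push_cast
    field_simp
    ring
  have h1 := hδ' ρ (N * c - K)
  rw [e] at h1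
  have h2 := (hmin ρ hmem).trans (h1 (mul_pos (by linarith) hN'))
  rw [← div_le_iff₀ hN'] at h2
  linarith

/-- Threshold rounding of a timing gives a `Rounding`. -/
theorem OpenCell.rounding {N C c : ℕ} {b x x' : ℝ} (hx : OpenCell N b x) (hx' : OpenCell N b x')
    (hx0 : 0 ≤ x) (hC : 0 < C) (hcell : SameCell (C * N) x x') {reset : ℕ → Bool} {r : ℕ → ℕ}
    (hr : ∀ i, r i = 0 ∨ r i ∣ C) {τ : ℕ → ℝ × ℝ} (hτ : Timing reset x τ) :
    Rounding reset r N c x x' τ (mapTiming reset (legStretch x b x') id τ)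
      (fun θ => mapTiming reset (legRound N x b x θ) (gridRound N θ) τ)
      (fun θ => mapTiming reset (legRound N x b x' θ) (gridRound N θ) τ) := by
  have hint : ∀ X n,
      Integrable (fun θ => tcost r (mapTiming reset (legRound N x b X θ) (gridRound N θ) τ) n)
        unitMeasure ∧
      ∫ θ, tcost r (mapTiming reset (legRound N x b X θ) (gridRound N θ) τ) n ∂unitMeasure =
        tcost r (mapTiming reset (legStretch x b X) id τ) n := by
    intro X n
    have key : ∀ i, Integrable (fun θ =>
        ((mapTiming reset (legRound N x b X θ) (gridRound N θ) τ i).2 -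
        (mapTiming reset (legRound N x b X θ) (gridRound N θ) τ i).1) * (r i : ℝ)) unitMeasure ∧
        ∫ θ, ((mapTiming reset (legRound N x b X θ) (gridRound N θ) τ i).2 -
        (mapTiming reset (legRound N x b X θ) (gridRound N θ) τ i).1) * (r i : ℝ) ∂unitMeasure =
        ((mapTiming reset (legStretch x b X) id τ i).2 -
        (mapTiming reset (legStretch x b X) id τ i).1) * (r i : ℝ) := by
      intro i
      by_cases hi : FirstLeg reset i
      · simp only [mapTiming_of_firstLeg hi]
        obtain ⟨a1, a2⟩ := integrable_legRound hx.pos x b X (τ i).1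
        obtain ⟨b1, b2⟩ := integrable_legRound hx.pos x b X (τ i).2
        exact ⟨(b1.sub a1).mul_const _, by
          rw [integral_mul_const, integral_sub b1 a1, a2, b2]⟩
      · simp only [mapTiming_of_not_firstLeg hi]
        obtain ⟨a1, a2⟩ := integrable_gridRound hx.pos (τ i).1
        obtain ⟨b1, b2⟩ := integrable_gridRound hx.pos (τ i).2
        exact ⟨(b1.sub a1).mul_const _, by
          rw [integral_mul_const, integral_sub b1 a1, a2, b2]; rfl⟩
    unfold tcost
    refine ⟨integrable_finsetSum _ fun i _ => (key i).1, ?_⟩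
    rw [integral_finsetSum _ fun i _ => (key i).1]
    exact Finset.sum_congr rfl fun i _ => (key i).2
  have hself : mapTiming reset (legStretch x b x) id τ = τ := by
    funext i
    by_cases hi : FirstLeg reset i
    · simp [mapTiming_of_firstLeg hi, hx.legStretch_self]
    · simp [mapTiming_of_not_firstLeg hi]
  have hmono := hx.legStretch_strictMonoOn hx'
  have hround : ∀ X, OpenCell N b X → ∀ θ ∈ Set.Ico (0 : ℝ) 1,
      Timing reset X (mapTiming reset (legRound N x b X θ) (gridRound N θ) τ) :=
    fun X hX θ hθ => hτ.map hx0 (hx.legRound_monotoneOn hX hθ)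
      ((gridRound_mono N θ).monotoneOn _) (hx.legRound_start hθ) (gridRound_zero N hθ)
  refine
    { timing := hτ
      timing' := hτ.map hx0 hmono.monotoneOn (monotone_id.monotoneOn _) hx.legStretch_start rfl
      tracks := hτ.tracks_map hx0 hmono (strictMono_id.strictMonoOn _)
        (fun y hy => hx.sameCell_legStretch hx' hy) (fun y _ => SameCell.refl N y)
      timingW := hround x hx
      timingW' := hround x' hx'
      weakly := fun θ hθ => hτ.weaklyTracks_map hx0
        (fun y hy => hx.inClosedCell_legRound hx' hθ hy)
        (fun y _ => inClosedCell_gridRound hx.pos hθ y)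
      integrable := fun n => (hint x n).1
      integral := fun n => by rw [(hint x n).2, hself]
      integrable' := fun n => (hint x' n).1
      integral' := fun n => (hint x' n).2
      sameSide := fun θ hθ n => ?_
      gap := ?_
      bound := ⟨1 + (b - x') / (b - x), ?_, fun n => ?_⟩ }
  · obtain ⟨K, ρ, h1, h2⟩ := hx.tcost_round hθ hr hτ n
    rw [h2, h2]
    exact hcell.side_iff hx.pos hC h1 K c
  · obtain ⟨ε, hε, h⟩ := exists_gap_below hx.pos hC x' c
    refine ⟨ε, hε, fun θ hθ n => ?_⟩
    obtain ⟨K, ρ, h1, h2⟩ := hx.tcost_round hθ hr hτ n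
    rw [h2]
    exact h K ρ h1
  · have h1 := hx.lt
    have h2 := hx'.lt
    have := div_pos (sub_pos.2 h2) (sub_pos.2 h1)
    linarith
  · have h1 := div_pos (sub_pos.2 hx'.lt) (sub_pos.2 hx.lt)
    unfold tcost
    rw [Finset.mul_sum]
    refine Finset.sum_le_sum fun i _ => ?_
    rw [← mul_assoc]
    refine mul_le_mul_of_nonneg_right ?_ (Nat.cast_nonneg _)
    by_cases hi : FirstLeg reset i
    · rw [mapTiming_of_firstLeg hi]
      exact hx.legStretch_sub_le hx' (hτ.le i)
    · rw [mapTiming_of_not_firstLeg hi]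
      have := mul_nonneg h1.le (sub_nonneg.2 (hτ.le i))
      simp only [id]
      linarith

/-- Two starting points in the same cell are either equal or in the same open cell. -/
theorem SameCell.eq_or_openCell {N : ℕ} (hN : 0 < N) {x y : ℝ} (h : SameCell N x y) :
    x = y ∨ ∃ b, OpenCell N b x ∧ OpenCell N b y := by
  have hN' : (0 : ℝ) < N := by exact_mod_cast hN
  have h1 := (h ⌊N * x⌋).1.1 (Int.floor_le _)
  rcases (Int.floor_le (N * x)).eq_or_lt with he | hl
  · left
    have := (h ⌊N * x⌋).2.1 he.ge
    nlinarith
  · right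
    have h2 : (⌊N * x⌋ : ℝ) < N * y := lt_of_not_ge fun h' => hl.not_ge ((h _).2.2 h')
    have h3 : N * y < ⌊N * x⌋ + 1 := by
      refine lt_of_not_ge fun h' => ?_
      have := (h (⌊N * x⌋ + 1)).1.2 (by push_cast; exact h')
      push_cast at this
      exact this.not_gt (Int.lt_floor_add_one _)
    have e : (N : ℝ) * (((⌊N * x⌋ : ℝ) + 1) / N) = ⌊N * x⌋ + 1 := by field_simp
    refine ⟨((⌊N * x⌋ : ℝ) + 1) / N, ⟨hN, ⟨_, e⟩, ?_, ?_⟩, ⟨hN, ⟨_, e⟩, ?_, ?_⟩⟩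
    · linarith
    · rw [lt_div_iff₀ hN']; linarith [Int.lt_floor_add_one ((N : ℝ) * x)]
    · linarith
    · rw [lt_div_iff₀ hN']; linarith

theorem Tracks.refl (N : ℕ) (τ : ℕ → ℝ × ℝ) : Tracks N τ τ :=
  ⟨fun _ => SameCell.refl _ _, fun _ => SameCell.refl _ _, fun _ => Iff.rfl⟩

/-- A timing can be tracked from any starting point of the same cell of the refined grid,
with the same costs relative to an integer bound. -/
theorem Timing.exists_sameSide {N C : ℕ} (hN : 0 < N) (hC : 0 < C) {x x' : ℝ} (hx : 0 ≤ x)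
    (hcell : SameCell (C * N) x x') {reset : ℕ → Bool} {r : ℕ → ℕ}
    (hr : ∀ i, r i = 0 ∨ r i ∣ C) {τ : ℕ → ℝ × ℝ} (hτ : Timing reset x τ) (c : ℕ) :
    ∃ σ, Timing reset x' σ ∧ Tracks N τ σ ∧ SameSide r c τ σ := by
  rcases (hcell.of_dvd (dvd_mul_left N C) (Nat.mul_pos hC hN)).eq_or_openCell hN with
    rfl | ⟨b, hb, hb'⟩
  · exact ⟨τ, hτ, Tracks.refl N τ, fun n => ⟨Iff.rfl, Iff.rfl⟩⟩
  · exact (hb.rounding (c := c) hb' hx hC hcell hr hτ).exists_sameSide (Nat.cast_nonneg c)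

/-- A timing can be tracked from any starting point of the same cell. -/
theorem Timing.exists_tracks {N : ℕ} (hN : 0 < N) {x x' : ℝ} (hx : 0 ≤ x)
    (hcell : SameCell N x x') {reset : ℕ → Bool} {τ : ℕ → ℝ × ℝ} (hτ : Timing reset x τ) :
    ∃ σ, Timing reset x' σ ∧ Tracks N τ σ := by
  obtain ⟨σ, h1, h2, -⟩ := hτ.exists_sameSide (C := 1) (r := fun _ => 0) hN one_pos hx
    (by rwa [one_mul]) (fun _ => Or.inl rfl) 0
  exact ⟨σ, h1, h2⟩


/-! ## Runs and their timings -/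

/-- The transitions `e` and the timing `τ` underlie a run of `A` from `x` through the
locations `l`. -/
structure Trace (A : PTA Q) (l : ℕ → Q) (e : ℕ → PTrans Q) (x : ℝ) (τ : ℕ → ℝ × ℝ) :
    Prop where
  timing : Timing (fun i => (e i).reset) x τ
  mem : ∀ i, e i ∈ A.E
  src : ∀ i, (e i).src = l i
  tgt : ∀ i, (e i).tgt = l (i + 1)
  guard : ∀ i, PGuard.sat (e i).guard (τ i).2

theorem NonBlocking.sat_inv {A : PTA Q} (hnb : NonBlocking A) (q : Q) {v : ℝ} (hv : 0 ≤ v) :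
    PGuard.sat (A.Inv q) v := by
  obtain ⟨_, _, _, _, _, ⟨t, ht, _, _, h⟩, _⟩ := hnb q v hv
  simpa using h 0 le_rfl ht

theorem InfRun.exists_trace {A : PTA Q} (hdisc : ∀ e ∈ A.E, e.dcost = 0) {q : Q} {x : ℝ}
    (ρ : InfRun A (q, x)) :
    ∃ (e : ℕ → PTrans Q) (τ : ℕ → ℝ × ℝ), Trace A (fun i => (ρ.st i).1) e x τ ∧
      (∀ n, (τ n).1 = (ρ.st n).2) ∧
      ∀ n, ∑ i ∈ Finset.range n, ρ.cst i = tcost (fun i => A.rate (ρ.st i).1) τ n := by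
  have key : ∀ n, ∃ (e : PTrans Q) (v : ℝ), e ∈ A.E ∧ e.src = (ρ.st n).1 ∧
      e.tgt = (ρ.st (n + 1)).1 ∧ PGuard.sat e.guard v ∧ (ρ.st n).2 ≤ v ∧
      (ρ.st (n + 1)).2 = (if e.reset then 0 else v) ∧
      ρ.cst n = (v - (ρ.st n).2) * A.rate (ρ.st n).1 := by
    intro n
    obtain ⟨c₁, c₂, m, ⟨t, ht, rfl, rfl, -⟩, ⟨e, he, hs, ht', hg, hr, -, rfl⟩, hc⟩ := ρ.step n
    refine ⟨e, (ρ.st n).2 + t, he, hs, ht', hg, by linarith, hr, ?_⟩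
    rw [hc, hdisc e he]
    push_cast
    ring
  choose e v h1 h2 h3 h4 h5 h6 h7 using key
  refine ⟨e, fun n => ((ρ.st n).2, v n), ⟨⟨by rw [ρ.first], h5, h6⟩, h1, h2, h3, h4⟩,
    fun _ => rfl, fun n => Finset.sum_congr rfl fun i _ => h7 i⟩

theorem Trace.exists_run {A : PTA Q} (hnb : NonBlocking A) (hdisc : ∀ e ∈ A.E, e.dcost = 0)
    {l : ℕ → Q} {e : ℕ → PTrans Q} {x : ℝ} (hx : 0 ≤ x) {τ : ℕ → ℝ × ℝ}
    (h : Trace A l e x τ) :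
    ∃ ρ : InfRun A (l 0, x), (∀ n, ρ.st n = (l n, (τ n).1)) ∧
      ∀ n, ∑ i ∈ Finset.range n, ρ.cst i = tcost (fun i => A.rate (l i)) τ n := by
  refine ⟨⟨fun n => (l n, (τ n).1), fun n => ((τ n).2 - (τ n).1) * A.rate (l n),
    by rw [h.timing.init], fun n => ?_⟩, fun _ => rfl, fun _ => rfl⟩
  have h0 := h.timing.nonneg hx
  have hle := h.timing.le n
  refine ⟨_, 0, (l n, (τ n).2), ⟨(τ n).2 - (τ n).1, by linarith, by simp, rfl, ?_⟩,
    ⟨e n, h.mem n, h.src n, h.tgt n, h.guard n, h.timing.next n, ?_, ?_⟩, by simp⟩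
  · intro t ht _
    exact hnb.sat_inv _ (add_nonneg (h0 n) ht)
  · exact hnb.sat_inv _ (h0 (n + 1))
  · simp [hdisc _ (h.mem n)]

/-- Every run from clock value `x` is matched by a run from `x'` through the same locations,
with clock values related by `R` and costs on the same side of the constraint. -/
def Simulates (A : PTA Q) (R : ℝ → ℝ → Prop) (cmp : Cmp) (c : ℕ) (x x' : ℝ) : Prop :=
  ∀ (q : Q) (ρ : InfRun A (q, x)), ∃ ρ' : InfRun A (q, x'), ∀ n,
    (ρ'.st n).1 = (ρ.st n).1 ∧ R (ρ.st n).2 (ρ'.st n).2 ∧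
    (Cmp.sat cmp (∑ i ∈ Finset.range n, ρ.cst i) c ↔
      Cmp.sat cmp (∑ i ∈ Finset.range n, ρ'.cst i) c)

theorem Trace.simulates {A : PTA Q} (hnb : NonBlocking A) (hdisc : ∀ e ∈ A.E, e.dcost = 0)
    {R : ℝ → ℝ → Prop} {cmp : Cmp} {c : ℕ} {x x' : ℝ} (hx' : 0 ≤ x')
    (h : ∀ (l : ℕ → Q) (e : ℕ → PTrans Q) (τ : ℕ → ℝ × ℝ), Trace A l e x τ →
      ∃ σ, Timing (fun i => (e i).reset) x' σ ∧ ∀ n, R (τ n).1 (σ n).1 ∧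
        PGuard.sat (e n).guard (σ n).2 ∧
        (Cmp.sat cmp (tcost (fun i => A.rate (l i)) τ n) c ↔
          Cmp.sat cmp (tcost (fun i => A.rate (l i)) σ n) c)) :
    Simulates A R cmp c x x' := by
  intro q ρ
  obtain ⟨e, τ, h1, h2, h3⟩ := ρ.exists_trace hdisc
  obtain ⟨σ, h4, h5⟩ := h _ e τ h1
  obtain ⟨ρ', h6, h7⟩ := Trace.exists_run hnb hdisc hx'
    (⟨h4, h1.mem, h1.src, h1.tgt, fun n => (h5 n).2.1⟩ : Trace A _ e x' σ)
  have hq : (ρ.st 0).1 = q := by rw [ρ.first]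
  refine ⟨⟨ρ'.st, ρ'.cst, by rw [ρ'.first, hq], ρ'.step⟩, fun n => ⟨?_, ?_, ?_⟩⟩
  · rw [h6]
  · rw [h6, ← h2]
    exact (h5 n).1
  · rw [h3, h7]
    exact (h5 n).2.2

section Until

variable {AP : Type} {A : PTA Q} {L : Q → AP → Prop} {R : ℝ → ℝ → Prop} {φ ψ : WCTL AP}
  {x x' : ℝ} {cmp : Cmp} {c : ℕ}

/-- A state formula does not distinguish `R`-related clock values. -/
def Respects (A : PTA Q) (L : Q → AP → Prop) (R : ℝ → ℝ → Prop) (φ : WCTL AP) : Prop :=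
  ∀ q x x', R x x' → (WCTLsat A L φ (q, x) ↔ WCTLsat A L φ (q, x'))

theorem Respects.sat_iff (h : Respects A L R φ) {s s' : Q × ℝ} (h1 : s'.1 = s.1)
    (h2 : R s.2 s'.2) : WCTLsat A L φ s ↔ WCTLsat A L φ s' := by
  obtain ⟨q, y⟩ := s
  obtain ⟨q', y'⟩ := s'
  obtain rfl : q' = q := h1
  exact h q' y y' h2

theorem Simulates.sat_EU (h : Simulates A R cmp c x x') (hφ : Respects A L R φ)
    (hψ : Respects A L R ψ) {q : Q} (hs : WCTLsat A L (.EU φ cmp c ψ) (q, x)) :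
    WCTLsat A L (.EU φ cmp c ψ) (q, x') := by
  obtain ⟨ρ, π, h0, h1, h2, h3⟩ := hs
  obtain ⟨ρ', h'⟩ := h q ρ
  exact ⟨ρ', π, h0, (hψ.sat_iff (h' π).1 (h' π).2.1).1 h1,
    fun j hj hj' => (hφ.sat_iff (h' j).1 (h' j).2.1).1 (h2 j hj hj'), (h' π).2.2.1 h3⟩

theorem Simulates.sat_AU (h : Simulates A R cmp c x x') (hφ : Respects A L R φ)
    (hψ : Respects A L R ψ) {q : Q}
    (hs : WCTLsat A L (.AU φ cmp c ψ) (q, x')) :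
    WCTLsat A L (.AU φ cmp c ψ) (q, x) := by
  intro ρ
  obtain ⟨ρ', h'⟩ := h q ρ
  obtain ⟨π, h0, h1, h2, h3⟩ := hs ρ'
  exact ⟨π, h0, (hψ.sat_iff (h' π).1 (h' π).2.1).2 h1,
    fun j hj hj' => (hφ.sat_iff (h' j).1 (h' j).2.1).2 (h2 j hj hj'), (h' π).2.2.2 h3⟩

end Until

/-! ## Invariance of satisfaction within cells -/

theorem posLcm_pos (A : PTA Q) : 0 < posLcm A := by
  refine Nat.pos_of_ne_zero fun h => ?_
  rw [posLcm, Finset.lcm_eq_zero_iff] at h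
  obtain ⟨q, hq, h0⟩ := h
  simp [h0] at hq

theorem rate_eq_zero_or_dvd_posLcm (A : PTA Q) (q : Q) : A.rate q = 0 ∨ A.rate q ∣ posLcm A := by
  rcases Nat.eq_zero_or_pos (A.rate q) with h | h
  · exact Or.inl h
  · exact Or.inr (Finset.dvd_lcm (by simpa using h))

theorem SameSide.cmp_sat_iff {r : ℕ → ℕ} {c : ℝ} {τ σ : ℕ → ℝ × ℝ} (h : SameSide r c τ σ)
    (cmp : Cmp) (n : ℕ) : Cmp.sat cmp (tcost r τ n) c ↔ Cmp.sat cmp (tcost r σ n) c := by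
  obtain ⟨h1, h2⟩ := h n
  cases cmp <;> simp only [Cmp.sat, ← not_lt, le_antisymm_iff, h1, h2]

theorem Tracks.guard_sat {N : ℕ} (hN : 0 < N) {τ σ : ℕ → ℝ × ℝ} (h : Tracks N τ σ) {g : PGuard}
    {n : ℕ} (hg : PGuard.sat g (τ n).2) : PGuard.sat g (σ n).2 :=
  fun p hp => ((h.snd n).cmp_sat hN p.1 p.2).1 (hg p hp)

/-- Nonnegative values in the same cell. -/
def NonnegSameCell (N : ℕ) (x y : ℝ) : Prop := 0 ≤ x ∧ 0 ≤ y ∧ SameCell N x y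

theorem Respects.of_dvd {AP : Type} {A : PTA Q} {L : Q → AP → Prop} {φ : WCTL AP} {N N' : ℕ}
    (h : Respects A L (NonnegSameCell N) φ) (hN : N ∣ N') (hN' : 0 < N') :
    Respects A L (NonnegSameCell N') φ :=
  fun q x x' hx => h q x x' ⟨hx.1, hx.2.1, hx.2.2.of_dvd hN hN'⟩

theorem simulates_of_sameCell {A : PTA Q} (hnb : NonBlocking A)
    (hdisc : ∀ e ∈ A.E, e.dcost = 0) {N : ℕ} (hN : 0 < N) (cmp : Cmp) (c : ℕ) {x x' : ℝ}
    (hx : 0 ≤ x) (hx' : 0 ≤ x') (hcell : SameCell (posLcm A * N) x x') :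
    Simulates A (NonnegSameCell N) cmp c x x' := by
  refine Trace.simulates hnb hdisc hx' fun l e τ h => ?_
  obtain ⟨σ, h1, h2, h3⟩ := h.timing.exists_sameSide hN (posLcm_pos A) hx hcell
    (r := fun i => A.rate (l i)) (fun i => rate_eq_zero_or_dvd_posLcm A (l i)) c
  exact ⟨σ, h1, fun n => ⟨⟨h.timing.nonneg hx n, h1.nonneg hx' n, h2.fst n⟩,
    h2.guard_sat hN (h.guard n), h3.cmp_sat_iff cmp n⟩⟩

theorem simulates_of_sameCell_of_trivial {A : PTA Q} (hnb : NonBlocking A)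
    (hdisc : ∀ e ∈ A.E, e.dcost = 0) {N : ℕ} (hN : 0 < N) {cmp : Cmp} {c : ℕ}
    (htriv : isTrivialC cmp c = true) {x x' : ℝ}
    (hx : 0 ≤ x) (hx' : 0 ≤ x') (hcell : SameCell N x x') :
    Simulates A (NonnegSameCell N) cmp c x x' := by
  refine Trace.simulates hnb hdisc hx' fun l e τ h => ?_
  obtain ⟨σ, h1, h2⟩ := h.timing.exists_tracks hN hx hcell
  refine ⟨σ, h1, fun n => ⟨⟨h.timing.nonneg hx n, h1.nonneg hx' n, h2.fst n⟩,
    h2.guard_sat hN (h.guard n), ?_⟩⟩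
  have h3 := h.timing.tcost_nonneg (fun i => A.rate (l i)) n
  have h4 := h1.tcost_nonneg (fun i => A.rate (l i)) n
  match cmp, c, htriv with
  | .ge, 0, _ => simp [Cmp.sat, h3, h4]

theorem simulates_of_sameCell_cheight {A : PTA Q} (hnb : NonBlocking A)
    (hdisc : ∀ e ∈ A.E, e.dcost = 0) (k : ℕ) (cmp : Cmp) (c : ℕ) {x x' : ℝ}
    (h : NonnegSameCell (posLcm A ^ (k + if isTrivialC cmp c then 0 else 1)) x x') :
    Simulates A (NonnegSameCell (posLcm A ^ k)) cmp c x x' := by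
  obtain ⟨hx, hx', hcell⟩ := h
  have hN := pow_pos (posLcm_pos A) k
  split_ifs at hcell with ht
  · exact simulates_of_sameCell_of_trivial hnb hdisc hN ht hx hx' hcell
  · exact simulates_of_sameCell hnb hdisc hN cmp c hx hx' (by rwa [← pow_succ'])

theorem NonnegSameCell.symm {N : ℕ} {x y : ℝ} (h : NonnegSameCell N x y) :
    NonnegSameCell N y x := ⟨h.2.1, h.1, h.2.2.symm⟩

/-- Satisfaction of `φ` is constant on the cells of the grid of step `1 / C ^ h(φ)`. -/
theorem respects_sameCell {AP : Type} {A : PTA Q} (L : Q → AP → Prop) (hnb : NonBlocking A)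
    (hdisc : ∀ e ∈ A.E, e.dcost = 0) (φ : WCTL AP) :
    Respects A L (NonnegSameCell (posLcm A ^ cheight φ)) φ := by
  have hpos := fun k => pow_pos (posLcm_pos A) k
  have hmax : ∀ {φ : WCTL AP} {k : ℕ}, cheight φ ≤ k →
      Respects A L (NonnegSameCell (posLcm A ^ cheight φ)) φ →
      Respects A L (NonnegSameCell (posLcm A ^ k)) φ :=
    fun hk h => h.of_dvd (pow_dvd_pow _ hk) (hpos _)
  induction φ with
  | tt => exact fun _ _ _ _ => Iff.rfl
  | atom a => exact fun _ _ _ _ => Iff.rfl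
  | not φ ih => exact fun q x x' h => not_congr (ih q x x' h)
  | or φ ψ ihφ ihψ =>
    exact fun q x x' h => or_congr (hmax (le_max_left _ _) ihφ q x x' h)
      (hmax (le_max_right _ _) ihψ q x x' h)
  | EU φ cmp c ψ ihφ ihψ =>
    exact fun q x x' h =>
      ⟨(simulates_of_sameCell_cheight hnb hdisc _ cmp c h).sat_EU (hmax (le_max_left _ _) ihφ)
          (hmax (le_max_right _ _) ihψ),
        (simulates_of_sameCell_cheight hnb hdisc _ cmp c h.symm).sat_EU
          (hmax (le_max_left _ _) ihφ) (hmax (le_max_right _ _) ihψ)⟩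
  | AU φ cmp c ψ ihφ ihψ =>
    exact fun q x x' h =>
      ⟨(simulates_of_sameCell_cheight hnb hdisc _ cmp c h.symm).sat_AU
          (hmax (le_max_left _ _) ihφ) (hmax (le_max_right _ _) ihψ),
        (simulates_of_sameCell_cheight hnb hdisc _ cmp c h).sat_AU (hmax (le_max_left _ _) ihφ)
          (hmax (le_max_right _ _) ihψ)⟩

/-! ## Invariance of satisfaction beyond the maximal constant -/

/-- `x` and `y` are equal or both beyond `M`. -/
def EqOrBeyond (M : ℕ) (x y : ℝ) : Prop := x = y ∨ ((M : ℝ) < x ∧ (M : ℝ) < y)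

theorem EqOrBeyond.cmp_sat {M : ℕ} {x y : ℝ} (h : EqOrBeyond M x y) {c : ℕ} (hc : c ≤ M)
    {o : Cmp} (hs : Cmp.sat o x c) : Cmp.sat o y c := by
  rcases h with rfl | ⟨h1, h2⟩
  · exact hs
  · have hc' : (c : ℝ) ≤ M := by exact_mod_cast hc
    cases o <;> simp only [Cmp.sat] at hs ⊢ <;> linarith

theorem EqOrBeyond.symm {M : ℕ} {x y : ℝ} (h : EqOrBeyond M x y) : EqOrBeyond M y x :=
  h.imp Eq.symm And.symm

theorem EqOrBeyond.mapTiming {M : ℕ} {reset : ℕ → Bool} {x x' : ℝ} {τ : ℕ → ℝ × ℝ}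
    (hx : (M : ℝ) < x) (hx' : (M : ℝ) < x') (hτ : Timing reset x τ) (n : ℕ) :
    EqOrBeyond M (τ n).1 (mapTiming reset (· + (x' - x)) id τ n).1 ∧
      EqOrBeyond M (τ n).2 (_root_.mapTiming reset (· + (x' - x)) id τ n).2 := by
  by_cases hn : FirstLeg reset n
  · rw [mapTiming_of_firstLeg hn]
    have h1 := hτ.le_of_firstLeg hn
    have h2 := hτ.le n
    exact ⟨Or.inr ⟨by linarith, by simp only; linarith⟩,
      Or.inr ⟨by linarith, by simp only; linarith⟩⟩
  · rw [mapTiming_of_not_firstLeg hn]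
    exact ⟨Or.inl rfl, Or.inl rfl⟩

theorem tcost_mapTiming_add (reset : ℕ → Bool) (r : ℕ → ℕ) (d : ℝ) (τ : ℕ → ℝ × ℝ) (n : ℕ) :
    tcost r (mapTiming reset (· + d) id τ) n = tcost r τ n := by
  refine Finset.sum_congr rfl fun i _ => ?_
  by_cases hi : FirstLeg reset i
  · simp [mapTiming_of_firstLeg hi]
  · simp [mapTiming_of_not_firstLeg hi]

theorem simulates_of_beyond {A : PTA Q} (hnb : NonBlocking A)
    (hdisc : ∀ e ∈ A.E, e.dcost = 0) {M : ℕ} (hM : ∀ c ∈ PTA.consts A, c ≤ M) (cmp : Cmp) (c : ℕ)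
    {x x' : ℝ} (hx : (M : ℝ) < x) (hx' : (M : ℝ) < x') :
    Simulates A (EqOrBeyond M) cmp c x x' := by
  have hM0 : (0 : ℝ) ≤ M := Nat.cast_nonneg M
  refine Trace.simulates hnb hdisc (by linarith) fun l e τ h => ?_
  refine ⟨mapTiming (fun i => (e i).reset) (· + (x' - x)) id τ,
    h.timing.map (by linarith) (fun _ _ _ _ h => by simpa using h) (monotone_id.monotoneOn _)
      (by ring) rfl, fun n => ?_⟩
  have hn := EqOrBeyond.mapTiming hx hx' h.timing n
  refine ⟨hn.1, fun p hp => hn.2.cmp_sat (hM _ ?_) (h.guard n p hp), ?_⟩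
  · exact Or.inl ⟨e n, h.mem n, p, hp, rfl⟩
  · rw [tcost_mapTiming_add]

theorem respects_beyond {AP : Type} {A : PTA Q} (L : Q → AP → Prop) (hnb : NonBlocking A)
    (hdisc : ∀ e ∈ A.E, e.dcost = 0) {M : ℕ} (hM : ∀ c ∈ PTA.consts A, c ≤ M) (φ : WCTL AP) :
    Respects A L (EqOrBeyond M) φ := by
  induction φ with
  | tt => exact fun _ _ _ _ => Iff.rfl
  | atom a => exact fun _ _ _ _ => Iff.rfl
  | not φ ih => exact fun q x x' h => not_congr (ih q x x' h)
  | or φ ψ ihφ ihψ => exact fun q x x' h => or_congr (ihφ q x x' h) (ihψ q x x' h)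
  | EU φ cmp c ψ ihφ ihψ =>
    rintro q x x' (rfl | ⟨h, h'⟩)
    · exact Iff.rfl
    · exact ⟨(simulates_of_beyond hnb hdisc hM cmp c h h').sat_EU ihφ ihψ,
        (simulates_of_beyond hnb hdisc hM cmp c h' h).sat_EU ihφ ihψ⟩
  | AU φ cmp c ψ ihφ ihψ =>
    rintro q x x' (rfl | ⟨h, h'⟩)
    · exact Iff.rfl
    · exact ⟨(simulates_of_beyond hnb hdisc hM cmp c h' h).sat_AU ihφ ihψ,
        (simulates_of_beyond hnb hdisc hM cmp c h h').sat_AU ihφ ihψ⟩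

/-! ## Decomposition into intervals -/

/-- A set of nonnegative numbers which is a union of cells of the grid of step `1 / D` and
contains all or none of the numbers beyond `M` is a finite union of intervals. -/
theorem exists_intervals_of_cells {D M : ℕ} (hD : 0 < D) {S : Set ℝ} (hS : ∀ x ∈ S, 0 ≤ x)
    (hcell : ∀ x y, NonnegSameCell D x y → x ∈ S → y ∈ S)
    (hbeyond : ∀ x y, EqOrBeyond M x y → x ∈ S → y ∈ S) :
    ∃ (k : ℕ) (sh : Fin k → IShape) (lo hi : Fin k → ℝ),
      (S = ⋃ i : Fin k, mkInterval (sh i) (lo i) (hi i)) ∧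
      (∀ i : Fin k, ∃ m : ℕ, lo i = (m : ℝ) / (D : ℝ)) ∧
      (∀ i : Fin k, lo i ≤ (M : ℝ)) ∧
      (∀ i : Fin k, sh i ≠ IShape.ci → sh i ≠ IShape.oi →
        (∃ m : ℕ, hi i = (m : ℝ) / (D : ℝ)) ∧ hi i ≤ (M : ℝ)) := by
  have hD' : (0 : ℝ) < D := by exact_mod_cast hD
  let J := Fin (M * D + 1) × Bool
  let sh : J → IShape := fun p => if p.2 then (if (p.1 : ℕ) < M * D then .oo else .oi) else .cc
  let lo : J → ℝ := fun p => ((p.1 : ℕ) : ℝ) / D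
  let top : J → ℕ := fun p => if p.2 then p.1 + 1 else p.1
  let hi : J → ℝ := fun p => (top p : ℝ) / D
  let I := {p : J // mkInterval (sh p) (lo p) (hi p) ⊆ S}
  have : Finite I := inferInstance
  have : Fintype I := Fintype.ofFinite I
  let f : Fin (Fintype.card I) ≃ I := (Fintype.equivFin I).symm
  have hle : ∀ m : ℕ, m ≤ M * D → (m : ℝ) / D ≤ M := fun m hm => by
    rw [div_le_iff₀ hD']
    exact_mod_cast hm
  refine ⟨_, fun i => sh (f i).1, fun i => lo (f i).1, fun i => hi (f i).1, ?_,
    fun i => ⟨_, rfl⟩, fun i => hle _ (Nat.lt_succ_iff.1 (f i).1.1.2),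
    fun i _ h2 => ⟨⟨_, rfl⟩, hle _ ?_⟩⟩
  · refine Set.Subset.antisymm (fun x hx => ?_) (Set.iUnion_subset fun i => (f i).2)
    suffices ∃ p : J, x ∈ mkInterval (sh p) (lo p) (hi p) ∧
        mkInterval (sh p) (lo p) (hi p) ⊆ S by
      obtain ⟨p, hp, hpS⟩ := this
      refine Set.mem_iUnion.2 ⟨f.symm ⟨p, hpS⟩, ?_⟩
      simpa using hp
    have hx0 := hS x hx
    rcases lt_or_ge (M : ℝ) x with hMx | hxM
    · have e : ((M * D : ℕ) : ℝ) / D = M := by push_cast; field_simp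
      have hint : ∀ y, y ∈ mkInterval (sh (Fin.last (M * D), true))
          (lo (Fin.last (M * D), true)) (hi (Fin.last (M * D), true)) ↔ (M : ℝ) < y := by
        intro y
        simp [sh, lo, mkInterval, hD'.ne']
      exact ⟨(Fin.last _, true), (hint x).2 hMx,
        fun y hy => hbeyond x y (Or.inr ⟨hMx, (hint y).1 hy⟩) hx⟩
    · have hDx : 0 ≤ D * x := mul_nonneg hD'.le hx0
      have hDM : D * x ≤ ((M * D : ℕ) : ℝ) := by push_cast; nlinarith
      have h1 := Nat.floor_le hDx
      have h2 := Nat.lt_floor_add_one (D * x)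
      have h3 : ⌊D * x⌋₊ ≤ M * D := Nat.floor_le_of_le hDM
      rcases h1.eq_or_lt with he | hl
      · have hint : mkInterval (sh (⟨⌊D * x⌋₊, Nat.lt_succ_iff.2 h3⟩, false))
            (lo (⟨⌊D * x⌋₊, Nat.lt_succ_iff.2 h3⟩, false))
            (hi (⟨⌊D * x⌋₊, Nat.lt_succ_iff.2 h3⟩, false)) = {x} := by
          simp [sh, lo, hi, top, mkInterval, he, hD'.ne']
        exact ⟨_, hint ▸ Set.mem_singleton x, hint ▸ Set.singleton_subset_iff.2 hx⟩
      · have h4 : ⌊D * x⌋₊ < M * D := by exact_mod_cast hl.trans_le hDM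
        have hint : ∀ y, y ∈ mkInterval (sh (⟨⌊D * x⌋₊, Nat.lt_succ_iff.2 h3⟩, true))
            (lo (⟨⌊D * x⌋₊, Nat.lt_succ_iff.2 h3⟩, true))
            (hi (⟨⌊D * x⌋₊, Nat.lt_succ_iff.2 h3⟩, true)) ↔
            (⌊D * x⌋₊ : ℝ) < D * y ∧ D * y < ⌊D * x⌋₊ + 1 := by
          intro y
          simp [sh, lo, hi, top, mkInterval, h4, div_lt_iff₀' hD', lt_div_iff₀' hD']
        refine ⟨_, (hint x).2 ⟨hl, h2⟩, fun y hy => hcell x y ⟨hx0, ?_, ?_⟩ hx⟩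
        · have := ((Nat.cast_nonneg _).trans_lt ((hint y).1 hy).1)
          exact (pos_of_mul_pos_right this hD'.le).le
        · exact sameCell_of_mem_Ioo (k := (⌊D * x⌋₊ : ℤ)) (by exact_mod_cast hl)
            (by exact_mod_cast h2) (by exact_mod_cast ((hint y).1 hy).1)
            (by exact_mod_cast ((hint y).1 hy).2)
  · have h3 := (f i).1.1.2
    simp only [sh] at h2
    simp only [top]
    split_ifs at h2 ⊢
    · omega
    · exact absurd rfl h2
    · omega

/-- **Lemma 5.** For a one-clock PTA `A` with a single cost function and all
discrete costs 0, and `Φ = EφU_{∼c}ψ`, the set of (nonnegative) clock values `x` such that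
`(q,x) ⊨ Φ` is a finite union of intervals whose bounds are integral multiples of
`1 / C ^ h(Φ)` (`C` the lcm of the positive cost rates), the largest finite bound being at
most the maximal guard constant `M`. -/
theorem stmt5 {Q AP : Type} [Fintype Q] (A : PTA Q) (L : Q → AP → Prop)
    (hnb : NonBlocking A) (hdisc : ∀ e ∈ A.E, e.dcost = 0)
    (M : ℕ) (hM : ∀ c ∈ PTA.consts A, c ≤ M)
    (φ ψ : WCTL AP) (cmp : Cmp) (c : ℕ) (q : Q) :
    ∃ (k : ℕ) (sh : Fin k → IShape) (lo hi : Fin k → ℝ),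
      ({x : ℝ | 0 ≤ x ∧ WCTLsat A L (.EU φ cmp c ψ) (q, x)} =
        ⋃ i : Fin k, mkInterval (sh i) (lo i) (hi i)) ∧
      (∀ i : Fin k,
        ∃ m : ℕ, lo i = (m : ℝ) / ((posLcm A ^ cheight (WCTL.EU φ cmp c ψ) : ℕ) : ℝ)) ∧
      (∀ i : Fin k, lo i ≤ (M : ℝ)) ∧
      (∀ i : Fin k, sh i ≠ IShape.ci → sh i ≠ IShape.oi →
        (∃ m : ℕ, hi i = (m : ℝ) / ((posLcm A ^ cheight (WCTL.EU φ cmp c ψ) : ℕ) : ℝ)) ∧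
        hi i ≤ (M : ℝ)) := by
  have hnonneg : (0 : ℝ) ≤ M := Nat.cast_nonneg M
  refine exists_intervals_of_cells (pow_pos (posLcm_pos A) _) (fun x hx => hx.1)
    (fun x y h hx => ⟨h.2.1, (respects_sameCell L hnb hdisc _ q x y h).1 hx.2⟩)
    (fun x y h hx => ⟨?_, (respects_beyond L hnb hdisc hM _ q x y h).1 hx.2⟩)
  rcases h with rfl | ⟨-, h⟩
  · exact hx.1
  · exact hnonneg.trans h.le
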